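/- arXiv:1801.08109 — 2 statements merged into one kernel-verified Lean document; each statement's English description precedes it below -/
import Mathlib

section
/- Let μ ∈ C_c^∞(ℂ) with ‖μ‖_∞ = k < 1, let S(w,z) = 1/(π(w − z + μ(w)(w̄ − z̄))), let D ⊂ ℂ be an open disk, and let φ ∈ C_c^∞(D). Then for every w ∈ D: ∫_D φ(z) [∂_z̄ S(w,z) − ∂_z(μ(z) S(w,z))] dA(z) = φ(w) − ∫_D S(w,z) (∂_z̄ φ(z) − μ(z) ∂_z φ(z)) dA(z), where the derivatives of S are taken in the z-variable. -/
open MeasureTheory Complex ENNReal NNReal Metric Set Filter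

/-- The Wirtinger derivative `∂_z f = (∂_x f - i ∂_y f)/2` of `f : ℂ → ℂ`,
computed from the real Fréchet derivative. -/
noncomputable def dZ (f : ℂ → ℂ) (z : ℂ) : ℂ :=
  (fderiv ℝ f z 1 - Complex.I * fderiv ℝ f z Complex.I) / 2

/-- The Wirtinger derivative `∂_z̄ f = (∂_x f + i ∂_y f)/2` of `f : ℂ → ℂ`. -/
noncomputable def dZbar (f : ℂ → ℂ) (z : ℂ) : ℂ :=
  (fderiv ℝ f z 1 + Complex.I * fderiv ℝ f z Complex.I) / 2

/-- `g` is the weak (distributional) Wirtinger derivative `∂_z u`, defined by testing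
against smooth compactly supported functions: `∫ u ∂_z φ = -∫ g φ`. -/
def HasWeakDz (u g : ℂ → ℂ) : Prop :=
  ∀ φ : ℂ → ℂ, ContDiff ℝ (⊤ : ℕ∞) φ → HasCompactSupport φ →
    (∫ z : ℂ, u z * dZ φ z) = - ∫ z : ℂ, g z * φ z

/-- `g` is the weak (distributional) Wirtinger derivative `∂_z̄ u`. -/
def HasWeakDzbar (u g : ℂ → ℂ) : Prop :=
  ∀ φ : ℂ → ℂ, ContDiff ℝ (⊤ : ℕ∞) φ → HasCompactSupport φ →
    (∫ z : ℂ, u z * dZbar φ z) = - ∫ z : ℂ, g z * φ z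

/-- The pseudo-fundamental solution `S(w,z) = 1/(π (w - z + μ(w)(w̄ - z̄)))` of the
Beltrami equation. -/
noncomputable def Sker (μ : ℂ → ℂ) (w z : ℂ) : ℂ :=
  1 / ((Real.pi : ℂ) * (w - z + μ w * ((starRingEnd ℂ) w - (starRingEnd ℂ) z)))

theorem fderiv_apply_eq_dZ_add_dZbar (f : ℂ → ℂ) (z v : ℂ) :
    fderiv ℝ f z v = dZ f z * v + dZbar f z * (starRingEnd ℂ) v := by
  have hv : fderiv ℝ f z v = v.re * fderiv ℝ f z 1 + v.im * fderiv ℝ f z I := by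
    conv_lhs => rw [show v = v.re • (1 : ℂ) + v.im • I by simp [Complex.re_add_im]]
    rw [map_add, map_smul, map_smul, Complex.real_smul, Complex.real_smul]
  have h1 : v = v.re + v.im * I := (Complex.re_add_im v).symm
  have h2 : (starRingEnd ℂ) v = v.re - v.im * I := by
    apply Complex.ext <;> simp
  rw [hv, h2, dZ, dZbar]
  conv_rhs => rw [h1]
  simp only [Complex.add_re, Complex.add_im, Complex.ofReal_re, Complex.ofReal_im, Complex.mul_re,
    Complex.mul_im, Complex.I_re, Complex.I_im, mul_zero, mul_one, sub_zero, add_zero, zero_add]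
  ring_nf
  simp only [Complex.I_sq]
  ring

theorem integrableOn_polar_rect {G : ℝ × ℝ → ℂ} (hG : Continuous G) {R : ℝ}
    (h0 : ∀ p : ℝ × ℝ, R < p.1 → G p = 0) :
    IntegrableOn G (Ioi (0 : ℝ) ×ˢ Ioo (-Real.pi) Real.pi) := by
  refine IntegrableOn.of_forall_sdiff_eq_zero (s := Icc 0 R ×ˢ Icc (-Real.pi) Real.pi)
    (hG.continuousOn.integrableOn_compact (isCompact_Icc.prod isCompact_Icc))
    (measurableSet_Ioi.prod measurableSet_Ioo) ?_
  rintro ⟨ρ, θ⟩ ⟨⟨h1, h2⟩, h3⟩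
  refine h0 _ (lt_of_not_ge fun h => h3 ⟨⟨le_of_lt h1, h⟩, ⟨h2.1.le, h2.2.le⟩⟩)

theorem hasDerivAt_comp_polar_radius {ψ : ℂ → ℂ} (hψ : ContDiff ℝ 1 ψ) (e : ℂ) (ρ : ℝ) :
    HasDerivAt (fun ρ : ℝ => ψ (ρ * e)) (fderiv ℝ ψ (ρ * e) e) ρ := by
  have h1 : HasDerivAt (fun ρ : ℝ => (ρ : ℂ) * e) e ρ := by
    simpa using (Complex.ofRealCLM.hasDerivAt (x := ρ)).mul_const e
  exact ((hψ.differentiable one_ne_zero) _).hasFDerivAt.comp_hasDerivAt ρ h1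

theorem hasDerivAt_comp_polar_angle {ψ : ℂ → ℂ} (hψ : ContDiff ℝ 1 ψ) (ρ θ : ℝ) :
    HasDerivAt (fun θ : ℝ => ψ (ρ * cexp (θ * I)))
      (ρ * fderiv ℝ ψ (ρ * cexp (θ * I)) (I * cexp (θ * I))) θ := by
  have h0 : HasDerivAt (fun θ : ℝ => (θ : ℂ) * I) I θ := by
    simpa using (Complex.ofRealCLM.hasDerivAt (x := θ)).mul_const I
  have h1 : HasDerivAt (fun θ : ℝ => (ρ : ℂ) * cexp (θ * I)) (ρ * (cexp (θ * I) * I)) θ :=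
    h0.cexp.const_mul _
  have h2 := ((hψ.differentiable one_ne_zero) _).hasFDerivAt.comp_hasDerivAt θ h1
  convert! h2 using 1
  rw [← Complex.real_smul, ← map_smul, Complex.real_smul, mul_comm I]

/-- The **Cauchy–Pompeiu formula** at the origin, for compactly supported functions. -/
theorem integral_dZbar_mul_inv {ψ : ℂ → ℂ} (hψ : ContDiff ℝ 1 ψ) (hc : HasCompactSupport ψ) :
    ∫ u : ℂ, dZbar ψ u * (1 / (Real.pi * u)) = - ψ 0 := by
  obtain ⟨R, hR⟩ := hc.isCompact.isBounded.subset_closedBall 0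
  have hψ0 : ∀ u : ℂ, R < ‖u‖ → u ∉ tsupport ψ := fun u hu h => by
    have := hR h
    simp only [mem_closedBall, dist_zero_right] at this
    linarith
  have hfd0 : ∀ u : ℂ, R < ‖u‖ → fderiv ℝ ψ u = 0 := fun u hu =>
    image_eq_zero_of_notMem_tsupport fun h => hψ0 u hu (tsupport_fderiv_subset ℝ h)
  have hnorm : ∀ p : ℝ × ℝ, R < p.1 → R < ‖(p.1 : ℂ) * cexp (p.2 * I)‖ := fun p hp => by
    rw [norm_mul, Complex.norm_exp_ofReal_mul_I, mul_one, Complex.norm_real]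
    exact hp.trans_le (le_abs_self _)
  set G₁ : ℝ × ℝ → ℂ := fun p => fderiv ℝ ψ (p.1 * cexp (p.2 * I)) (cexp (p.2 * I)) with hG₁
  set G₂ : ℝ × ℝ → ℂ := fun p => fderiv ℝ ψ (p.1 * cexp (p.2 * I)) (I * cexp (p.2 * I)) with hG₂
  have hcf := hψ.continuous_fderiv one_ne_zero
  have hcE : Continuous fun p : ℝ × ℝ => (p.1 : ℂ) * cexp (p.2 * I) := by fun_prop
  have hG₁c : Continuous G₁ := (hcf.comp hcE).clm_apply (by fun_prop)
  have hG₂c : Continuous G₂ := (hcf.comp hcE).clm_apply (by fun_prop)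
  have hi₁ := integrableOn_polar_rect hG₁c (R := R)
    (fun p hp => by simp only [hG₁, hfd0 _ (hnorm p hp), _root_.zero_apply])
  have hi₂ := integrableOn_polar_rect hG₂c (R := R)
    (fun p hp => by simp only [hG₂, hfd0 _ (hnorm p hp), _root_.zero_apply])
  have hI₁ : ∫ p in Ioi (0 : ℝ) ×ˢ Ioo (-Real.pi) Real.pi, G₁ p = - (2 * Real.pi) * ψ 0 := by
    have hswap : ∫ p in Ioi (0 : ℝ) ×ˢ Ioo (-Real.pi) Real.pi, G₁ p =
        ∫ θ in Ioo (-Real.pi) Real.pi, ∫ ρ in Ioi (0 : ℝ), G₁ (ρ, θ) := by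
      rw [Measure.volume_eq_prod, IntegrableOn, ← Measure.prod_restrict] at *
      exact integral_prod_symm _ hi₁
    have hin : ∀ θ : ℝ, ∫ ρ in Ioi (0 : ℝ), G₁ (ρ, θ) = - ψ 0 := fun θ => by
      have h := integral_Ioi_of_hasDerivAt_of_tendsto' (a := 0) (m := 0)
        (f := fun ρ : ℝ => ψ (ρ * cexp (θ * I))) (f' := fun ρ => G₁ (ρ, θ))
        (fun ρ _ => hasDerivAt_comp_polar_radius hψ _ ρ) ?_ ?_
      · rw [h]; simp
      · refine IntegrableOn.of_forall_sdiff_eq_zero (s := Icc 0 R)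
          ((hG₁c.comp (by fun_prop : Continuous fun ρ : ℝ => (ρ, θ))).continuousOn.integrableOn_compact
            isCompact_Icc) measurableSet_Ioi ?_
        rintro ρ ⟨h1, h2⟩
        have : R < ρ := lt_of_not_ge fun h => h2 ⟨le_of_lt h1, h⟩
        simp only [hG₁, hfd0 _ (hnorm (ρ, θ) this), _root_.zero_apply]
      · refine tendsto_const_nhds.congr' ?_
        filter_upwards [eventually_gt_atTop R] with ρ hρ
        exact (image_eq_zero_of_notMem_tsupport (hψ0 _ (hnorm (ρ, θ) hρ))).symm
    rw [hswap]
    simp only [hin]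
    rw [setIntegral_const, Real.volume_real_Ioo_of_le (by linarith [Real.pi_pos]),
      Complex.real_smul]
    push_cast
    ring
  have hI₂ : ∫ p in Ioi (0 : ℝ) ×ˢ Ioo (-Real.pi) Real.pi, G₂ p = 0 := by
    rw [Measure.volume_eq_prod] at hi₂ ⊢
    rw [setIntegral_prod _ hi₂]
    refine setIntegral_eq_zero_of_forall_eq_zero fun ρ hρ => ?_
    have hρ' : (ρ : ℂ) ≠ 0 := by exact_mod_cast (ne_of_gt hρ)
    have h := intervalIntegral.integral_eq_sub_of_hasDerivAt (a := -Real.pi) (b := Real.pi)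
      (f := fun θ : ℝ => ψ (ρ * cexp (θ * I))) (f' := fun θ => ρ * G₂ (ρ, θ))
      (fun θ _ => hasDerivAt_comp_polar_angle hψ ρ θ)
      ((continuous_const.mul (hG₂c.comp (by fun_prop : Continuous fun θ : ℝ => (ρ, θ)))).intervalIntegrable
        _ _)
    rw [intervalIntegral.integral_const_mul] at h
    have h' : ψ (ρ * cexp ((Real.pi : ℝ) * I)) - ψ (ρ * cexp (((-Real.pi : ℝ) : ℂ) * I)) = 0 := by
      push_cast
      rw [neg_mul, Complex.exp_neg, Complex.exp_pi_mul_I]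
      norm_num
    rw [h', mul_eq_zero, intervalIntegral.integral_of_le (by linarith [Real.pi_pos]),
      integral_Ioc_eq_integral_Ioo] at h
    exact h.resolve_left hρ'
  rw [← Complex.integral_comp_polarCoord_symm, polarCoord_target]
  have hcongr : ∀ p ∈ Ioi (0 : ℝ) ×ˢ Ioo (-Real.pi) Real.pi,
      p.1 • (dZbar ψ (Complex.polarCoord.symm p) * (1 / (Real.pi * Complex.polarCoord.symm p))) =
        (1 / (2 * Real.pi) : ℂ) * (G₁ p + I * G₂ p) := by
    rintro p ⟨hp, -⟩
    have hp' : (p.1 : ℂ) ≠ 0 := by exact_mod_cast (ne_of_gt hp)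
    have hpi : (Real.pi : ℂ) ≠ 0 := by exact_mod_cast Real.pi_ne_zero
    have he : Complex.polarCoord.symm p = p.1 * cexp (p.2 * I) := by
      rw [Complex.polarCoord_symm_apply, Complex.exp_mul_I]
      push_cast
      ring
    have hne : cexp (p.2 * I) ≠ 0 := Complex.exp_ne_zero _
    have hconj : (starRingEnd ℂ) (cexp (p.2 * I)) = (cexp (p.2 * I))⁻¹ := by
      rw [← Complex.exp_conj, ← Complex.exp_neg]
      simp
    simp only [hG₁, hG₂]
    rw [he, fderiv_apply_eq_dZ_add_dZbar, fderiv_apply_eq_dZ_add_dZbar, map_mul, hconj,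
      Complex.conj_I, Complex.real_smul]
    field_simp
    ring_nf
    simp only [Complex.I_sq]
    ring
  rw [setIntegral_congr_fun (measurableSet_Ioi.prod measurableSet_Ioo) hcongr, integral_const_mul,
    integral_add hi₁ (hi₂.const_mul I), integral_const_mul, hI₁, hI₂]
  have hpi : (Real.pi : ℂ) ≠ 0 := by exact_mod_cast Real.pi_ne_zero
  field_simp
  ring

theorem integrable_of_norm_le_inv_norm_sub {f : ℂ → ℂ} {w : ℂ} {C : ℝ}
    (hm : AEStronglyMeasurable f) (hb : ∀ z, ‖f z‖ ≤ C * ‖w - z‖⁻¹) (hc : HasCompactSupport f) :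
    Integrable f := by
  have hmp : MeasurePreserving (fun z : ℂ => w - z) := volume.measurePreserving_sub_left w
  have hl : LocallyIntegrable (fun z => f (w - z)) := by
    refine locallyIntegrable_of_norm_le_rpow (α := 1) (C := C) ?_ ?_ (ae_of_all _ fun z => ?_)
      (hm.comp_measurePreserving hmp)
    · simp [Complex.finrank_real_complex]
    · simp [Complex.finrank_real_complex]
    · simpa [Real.rpow_neg_one] using hb (w - z)
  have hc' : HasCompactSupport (fun z => f (w - z)) := hc.comp_homeomorph (Homeomorph.subLeft w)
  have hi : Integrable (fun z => f (w - z)) :=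
    (integrableOn_iff_integrable_of_support_subset (subset_tsupport _)).1
      (hl.integrableOn_isCompact hc'.isCompact)
  simpa using hi.comp_sub_left w

theorem integrable_slice {g : ℝ → ℂ} (hg : Continuous g) {R : ℝ} (h0 : ∀ x, R < |x| → g x = 0) :
    Integrable g := by
  refine hg.integrable_of_hasCompactSupport (HasCompactSupport.of_support_subset_isCompact
    (isCompact_Icc (a := -R) (b := R)) fun x hx => ?_)
  by_contra h
  refine hx (h0 x (lt_of_not_ge fun h' => h ?_))
  exact abs_le.1 h'

/-- If `g` is compactly supported and differentiable off one point, with integrable derivative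
in the direction `1`, then that derivative has zero integral. -/
theorem integral_fderiv_one_eq_zero {g : ℂ → ℂ} {w : ℂ}
    (hd : ∀ z, z ≠ w → DifferentiableAt ℝ g z) (hc : HasCompactSupport g)
    (hi : Integrable fun z => fderiv ℝ g z 1) :
    ∫ z, fderiv ℝ g z 1 = 0 := by
  obtain ⟨R, hR⟩ := hc.isCompact.isBounded.subset_closedBall 0
  have h0 : ∀ z : ℂ, R < ‖z‖ → g z = 0 := fun z hz => image_eq_zero_of_notMem_tsupport fun h => by
    have := hR h
    simp only [mem_closedBall, dist_zero_right] at this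
    linarith
  have hmp := Complex.volume_preserving_equiv_real_prod.symm
  rw [← hmp.integral_comp Complex.measurableEquivRealProd.symm.measurableEmbedding]
  have hi' := (hmp.integrable_comp_emb
    Complex.measurableEquivRealProd.symm.measurableEmbedding).2 hi
  rw [Measure.volume_eq_prod] at hi' ⊢
  have hae : ∀ᵐ y : ℝ, y ≠ w.im := by simp [ae_iff]
  refine (integral_prod_symm _ hi').trans ?_
  refine integral_eq_zero_of_ae ?_
  filter_upwards [hi'.prod_left_ae, hae] with y hy hyw
  have hder : ∀ x : ℝ, HasDerivAt (fun x : ℝ => g ⟨x, y⟩) (fderiv ℝ g ⟨x, y⟩ 1) x := fun x => by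
    have h1 : HasDerivAt (fun x : ℝ => (⟨x, y⟩ : ℂ)) 1 x := by
      have := (Complex.ofRealCLM.hasDerivAt (x := x)).add_const ((y : ℂ) * I)
      convert! this using 1
      funext x
      exact Complex.mk_eq_add_mul_I x y
    exact (hd _ fun h => hyw (by rw [← h])).hasFDerivAt.comp_hasDerivAt x h1
  refine integral_eq_zero_of_hasDerivAt_of_integrable hder hy (integrable_slice (R := R) ?_ ?_)
  · exact continuous_iff_continuousAt.2 fun x => (hder x).continuousAt
  · exact fun x hx => h0 _ (hx.trans_le (Complex.abs_re_le_norm ⟨x, y⟩))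

/-- If `g` is compactly supported and differentiable off one point, with integrable derivative
in the direction `I`, then that derivative has zero integral. -/
theorem integral_fderiv_I_eq_zero {g : ℂ → ℂ} {w : ℂ}
    (hd : ∀ z, z ≠ w → DifferentiableAt ℝ g z) (hc : HasCompactSupport g)
    (hi : Integrable fun z => fderiv ℝ g z I) :
    ∫ z, fderiv ℝ g z I = 0 := by
  obtain ⟨R, hR⟩ := hc.isCompact.isBounded.subset_closedBall 0
  have h0 : ∀ z : ℂ, R < ‖z‖ → g z = 0 := fun z hz => image_eq_zero_of_notMem_tsupport fun h => by
    have := hR h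
    simp only [mem_closedBall, dist_zero_right] at this
    linarith
  have hmp := Complex.volume_preserving_equiv_real_prod.symm
  rw [← hmp.integral_comp Complex.measurableEquivRealProd.symm.measurableEmbedding]
  have hi' := (hmp.integrable_comp_emb
    Complex.measurableEquivRealProd.symm.measurableEmbedding).2 hi
  rw [Measure.volume_eq_prod] at hi' ⊢
  have hae : ∀ᵐ x : ℝ, x ≠ w.re := by simp [ae_iff]
  refine (integral_prod _ hi').trans ?_
  refine integral_eq_zero_of_ae ?_
  filter_upwards [hi'.prod_right_ae, hae] with x hx hxw
  have hder : ∀ y : ℝ, HasDerivAt (fun y : ℝ => g ⟨x, y⟩) (fderiv ℝ g ⟨x, y⟩ I) y := fun y => by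
    have h1 : HasDerivAt (fun y : ℝ => (⟨x, y⟩ : ℂ)) I y := by
      have := ((Complex.ofRealCLM.hasDerivAt (x := y)).mul_const I).const_add (x : ℂ)
      convert! this using 1
      · funext y
        exact Complex.mk_eq_add_mul_I x y
      · simp
    exact (hd _ fun h => hxw (by rw [← h])).hasFDerivAt.comp_hasDerivAt y h1
  refine integral_eq_zero_of_hasDerivAt_of_integrable hder hx (integrable_slice (R := R) ?_ ?_)
  · exact continuous_iff_continuousAt.2 fun y => (hder y).continuousAt
  · exact fun y hy => h0 _ (hy.trans_le (Complex.abs_im_le_norm ⟨x, y⟩))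

theorem dZ_mul {f g : ℂ → ℂ} {z : ℂ} (hf : DifferentiableAt ℝ f z)
    (hg : DifferentiableAt ℝ g z) :
    dZ (fun ζ => f ζ * g ζ) z = f z * dZ g z + dZ f z * g z := by
  simp only [dZ, fderiv_fun_mul hf hg, _root_.add_apply, _root_.smul_apply, smul_eq_mul]
  ring

theorem continuous_dZ {f : ℂ → ℂ} (hf : ContDiff ℝ 1 f) : Continuous (dZ f) := by
  have := hf.continuous_fderiv one_ne_zero
  unfold dZ
  fun_prop

theorem continuous_dZbar {f : ℂ → ℂ} (hf : ContDiff ℝ 1 f) : Continuous (dZbar f) := by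
  have := hf.continuous_fderiv one_ne_zero
  unfold dZbar
  fun_prop

theorem dZ_eq_zero_of_notMem_tsupport {f : ℂ → ℂ} {z : ℂ} (hz : z ∉ tsupport f) :
    dZ f z = 0 := by
  have : fderiv ℝ f z = 0 :=
    image_eq_zero_of_notMem_tsupport fun h => hz (tsupport_fderiv_subset ℝ h)
  simp [dZ, this]

theorem dZbar_eq_zero_of_notMem_tsupport {f : ℂ → ℂ} {z : ℂ} (hz : z ∉ tsupport f) :
    dZbar f z = 0 := by
  have : fderiv ℝ f z = 0 :=
    image_eq_zero_of_notMem_tsupport fun h => hz (tsupport_fderiv_subset ℝ h)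
  simp [dZbar, this]

/-- The real-linear map `ζ ↦ ζ + a ζ̄`. -/
noncomputable def beltramiCLM (a : ℂ) : ℂ →L[ℝ] ℂ :=
  ContinuousLinearMap.id ℝ ℂ + a • (Complex.conjCLE : ℂ →L[ℝ] ℂ)

theorem beltramiCLM_apply (a ζ : ℂ) : beltramiCLM a ζ = ζ + a * (starRingEnd ℂ) ζ := by
  simp [beltramiCLM]

theorem le_norm_beltramiCLM (a ζ : ℂ) : (1 - ‖a‖) * ‖ζ‖ ≤ ‖beltramiCLM a ζ‖ := by
  rw [beltramiCLM_apply]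
  have h := norm_sub_le_norm_add ζ (a * (starRingEnd ℂ) ζ)
  rw [norm_mul, RCLike.norm_conj] at h
  linarith

theorem beltramiCLM_ne_zero {a ζ : ℂ} (ha : ‖a‖ < 1) (hζ : ζ ≠ 0) : beltramiCLM a ζ ≠ 0 := by
  rw [← norm_pos_iff]
  exact (mul_pos (by linarith) (norm_pos_iff.2 hζ)).trans_le (le_norm_beltramiCLM a ζ)

theorem det_beltramiCLM (a : ℂ) : (beltramiCLM a).det = 1 - ‖a‖ ^ 2 := by
  rw [ContinuousLinearMap.det, ← LinearMap.det_toMatrix Complex.basisOneI, Matrix.det_fin_two,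
    Complex.sq_norm, Complex.normSq_apply]
  simp [LinearMap.toMatrix_apply, beltramiCLM_apply]
  ring

theorem one_sub_normSq_eq (a : ℂ) :
    (((1 - ‖a‖ ^ 2 : ℝ)) : ℂ) = 1 - a * (starRingEnd ℂ) a := by
  rw [Complex.mul_conj, Complex.sq_norm]
  push_cast
  rfl

/-- Change of variables `u = ζ + a ζ̄`. -/
theorem integral_comp_beltramiCLM {a : ℂ} (ha : ‖a‖ < 1) (F : ℂ → ℂ) :
    ∫ u, F u = ((1 - ‖a‖ ^ 2 : ℝ) : ℂ) * ∫ ζ, F (beltramiCLM a ζ) := by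
  have hpos : 0 < 1 - ‖a‖ ^ 2 := by nlinarith [norm_nonneg a]
  have hdet : LinearMap.det (beltramiCLM a : ℂ →ₗ[ℝ] ℂ) ≠ 0 := by
    have := det_beltramiCLM a
    rw [ContinuousLinearMap.det] at this
    rw [this]; exact hpos.ne'
  have hinj : Function.Injective (beltramiCLM a) :=
    ((LinearMap.equivOfDetNeZero _ hdet)).injective
  have hsurj : Function.Surjective (beltramiCLM a) :=
    ((LinearMap.equivOfDetNeZero _ hdet)).surjective
  have h := integral_image_eq_integral_abs_det_fderiv_smul volume (s := univ)
    (f := beltramiCLM a) (f' := fun _ => beltramiCLM a) MeasurableSet.univ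
    (fun x _ => (beltramiCLM a).hasFDerivWithinAt) hinj.injOn F
  rw [image_univ, hsurj.range_eq, setIntegral_univ, setIntegral_univ, integral_smul,
    det_beltramiCLM, abs_of_pos hpos, Complex.real_smul] at h
  exact h

theorem Sker_eq (μ : ℂ → ℂ) (w z : ℂ) :
    Sker μ w z = 1 / (Real.pi * beltramiCLM (μ w) (w - z)) := by
  rw [Sker, beltramiCLM_apply, map_sub]

/-- The pseudo-fundamental solution reproduces test functions for the Beltrami operator with the
coefficient frozen at `w`. -/
theorem integral_Sker_mul_frozen {μ φ : ℂ → ℂ} {w : ℂ} (ha : ‖μ w‖ < 1)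
    (hφ : ContDiff ℝ 1 φ) (hc : HasCompactSupport φ) :
    ∫ z, Sker μ w z * (dZbar φ z - μ w * dZ φ z) = φ w := by
  set a := μ w
  have hpos : 0 < 1 - ‖a‖ ^ 2 := by nlinarith [norm_nonneg a]
  set J : ℝ := 1 - ‖a‖ ^ 2 with hJ
  have hJc : (J : ℂ) ≠ 0 := by exact_mod_cast hpos.ne'
  have hJa : (J : ℂ) = 1 - a * (starRingEnd ℂ) a := one_sub_normSq_eq a
  set M : ℂ →L[ℝ] ℂ := J⁻¹ • beltramiCLM (-a) with hM
  have hMa : ∀ u, M u = (u - a * (starRingEnd ℂ) u) / J := fun u => by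
    simp only [hM, _root_.smul_apply, beltramiCLM_apply, Complex.real_smul]
    push_cast
    field_simp
    ring
  have hMT : ∀ ζ, M (beltramiCLM a ζ) = ζ := fun ζ => by
    rw [hMa, beltramiCLM_apply, div_eq_iff hJc, hJa]
    simp only [map_add, map_mul, Complex.conj_conj]
    ring
  have hTM : ∀ u, beltramiCLM a (M u) = u := fun u => by
    rw [hMa, beltramiCLM_apply]
    simp only [map_sub, map_mul, map_div₀, Complex.conj_conj, Complex.conj_ofReal]
    field_simp
    rw [hJa]; ring
  set ψ : ℂ → ℂ := fun u => φ (w - M u) with hψ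
  have hψd : ContDiff ℝ 1 ψ := hφ.comp (contDiff_const.sub M.contDiff)
  have hψc : HasCompactSupport ψ := by
    refine HasCompactSupport.of_support_subset_isCompact (hc.isCompact.image
      (f := fun z => beltramiCLM a (w - z)) (by fun_prop)) fun u hu => ?_
    exact ⟨w - M u, subset_tsupport _ hu, by simp only [_root_.sub_sub_cancel, hTM]⟩
  have hψbar : ∀ ζ, dZbar ψ (beltramiCLM a ζ) =
      -(dZbar φ (w - ζ) - a * dZ φ (w - ζ)) / J := fun ζ => by
    have hd : HasFDerivAt ψ (-(fderiv ℝ φ (w - ζ)).comp M) (beltramiCLM a ζ) := by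
      have h1 : HasFDerivAt (fun u => w - M u) (-M) (beltramiCLM a ζ) :=
        M.hasFDerivAt.const_sub w
      have h2 : HasFDerivAt φ (fderiv ℝ φ (w - ζ)) (w - M (beltramiCLM a ζ)) := by
        rw [hMT]; exact ((hφ.differentiable one_ne_zero) _).hasFDerivAt
      convert! HasFDerivAt.comp (beltramiCLM a ζ) h2 h1 using 1
      ext v
      simp
    rw [dZbar, hd.fderiv]
    simp only [_root_.neg_apply, ContinuousLinearMap.comp_apply, fderiv_apply_eq_dZ_add_dZbar φ,
      hMa, map_div₀, map_sub, map_mul, map_one, map_neg, Complex.conj_I,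
      Complex.conj_ofReal]
    field_simp
    ring_nf
    simp only [Complex.I_sq]
    ring
  have hCP := integral_dZbar_mul_inv hψd hψc
  rw [integral_comp_beltramiCLM ha, ← integral_const_mul] at hCP
  simp only [hψbar] at hCP
  rw [← integral_sub_left_eq_self _ volume w] at hCP
  have hψ0 : ψ 0 = φ w := by simp [hψ]
  rw [← neg_eq_iff_eq_neg, ← integral_neg, hψ0] at hCP
  rw [← hCP]
  refine integral_congr_ae (ae_of_all _ fun z => ?_)
  simp only [Sker_eq, _root_.sub_sub_cancel]
  rw [← hJ, show μ w = a from rfl]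
  field_simp

theorem norm_Sker_le {μ : ℂ → ℂ} {w : ℂ} (ha : ‖μ w‖ < 1) (z : ℂ) :
    ‖Sker μ w z‖ ≤ (Real.pi * (1 - ‖μ w‖))⁻¹ * ‖w - z‖⁻¹ := by
  rcases eq_or_ne (w - z) 0 with h | h
  · simp [Sker_eq, h]
  · have hp : 0 < 1 - ‖μ w‖ := by linarith
    have hn := norm_pos_iff.2 h
    rw [Sker_eq, one_div, norm_inv, norm_mul, Complex.norm_real, Real.norm_of_nonneg Real.pi_pos.le,
      ← mul_inv, mul_assoc]
    have := le_norm_beltramiCLM (μ w) (w - z)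
    have := Real.pi_pos
    gcongr

theorem measurable_Sker (μ : ℂ → ℂ) (w : ℂ) : Measurable (Sker μ w) := by
  have : Sker μ w = fun z => (Real.pi * beltramiCLM (μ w) (w - z))⁻¹ := by
    funext z; rw [Sker_eq, one_div]
  rw [this]
  have h : Continuous fun z => (Real.pi : ℂ) * beltramiCLM (μ w) (w - z) := by fun_prop
  exact h.measurable.inv

theorem hasFDerivAt_Sker {μ : ℂ → ℂ} {w z : ℂ} (ha : ‖μ w‖ < 1) (hz : z ≠ w) :
    HasFDerivAt (Sker μ w) ((Real.pi * Sker μ w z ^ 2) • beltramiCLM (μ w)) z := by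
  have hne : beltramiCLM (μ w) (w - z) ≠ 0 := beltramiCLM_ne_zero ha (sub_ne_zero.2 hz.symm)
  have hpi : (Real.pi : ℂ) ≠ 0 := by exact_mod_cast Real.pi_ne_zero
  have h1 : HasFDerivAt (fun ζ => (Real.pi : ℂ) * beltramiCLM (μ w) (w - ζ))
      ((Real.pi : ℂ) • -beltramiCLM (μ w)) z := by
    have h0 : HasFDerivAt (fun ζ => beltramiCLM (μ w) (w - ζ)) (-beltramiCLM (μ w)) z := by
      simp only [map_sub]
      exact (beltramiCLM (μ w)).hasFDerivAt.const_sub _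
    exact h0.const_mul _
  have h2 := (hasDerivAt_inv (mul_ne_zero hpi hne)).hasFDerivAt.restrictScalars ℝ |>.comp z h1
  have hS : Sker μ w = fun ζ => (Real.pi * beltramiCLM (μ w) (w - ζ))⁻¹ := by
    funext ζ; rw [Sker_eq, one_div]
  rw [hS]
  convert! h2 using 1
  ext v
  simp only [_root_.smul_apply, smul_eq_mul, ContinuousLinearMap.comp_apply,
    ContinuousLinearMap.coe_restrictScalars', ContinuousLinearMap.toSpanSingleton_apply,
    _root_.neg_apply]
  field_simp

theorem integrable_Sker_mul {μ h : ℂ → ℂ} {w : ℂ} (ha : ‖μ w‖ < 1) (hh : Continuous h)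
    (hc : HasCompactSupport h) : Integrable fun z => Sker μ w z * h z := by
  obtain ⟨C, hC⟩ := hc.exists_bound_of_continuous hh
  refine integrable_of_norm_le_inv_norm_sub (w := w) (C := (Real.pi * (1 - ‖μ w‖))⁻¹ * C)
    ((measurable_Sker μ w).mul hh.measurable).aestronglyMeasurable (fun z => ?_) hc.mul_left
  rw [norm_mul, mul_right_comm]
  have h0 := (norm_nonneg _).trans (norm_Sker_le ha z)
  refine mul_le_mul ?_ ?_ (norm_nonneg _) h0
  · exact norm_Sker_le ha z
  · exact hC z

theorem fderiv_mul_Sker {μ H : ℂ → ℂ} {w z : ℂ} (ha : ‖μ w‖ < 1) (hH : ContDiff ℝ 1 H)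
    (hz : z ≠ w) (v : ℂ) :
    fderiv ℝ (fun ζ => H ζ * Sker μ w ζ) z v =
      Sker μ w z * fderiv ℝ H z v +
        Real.pi * beltramiCLM (μ w) v * (H z * Sker μ w z ^ 2) := by
  have hS := hasFDerivAt_Sker ha hz
  rw [fderiv_fun_mul ((hH.differentiable one_ne_zero) z) hS.differentiableAt, hS.fderiv]
  simp only [_root_.add_apply, _root_.smul_apply, smul_eq_mul]
  ring

theorem integrable_mul_Sker_sq {μ H : ℂ → ℂ} {w : ℂ} (ha : ‖μ w‖ < 1) (hH : ContDiff ℝ 1 H)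
    (hc : HasCompactSupport H) (hw : H w = 0) :
    Integrable fun z => H z * Sker μ w z ^ 2 := by
  obtain ⟨C, hC⟩ := hH.lipschitzWith_of_hasCompactSupport hc one_ne_zero
  set K := (Real.pi * (1 - ‖μ w‖))⁻¹
  refine integrable_of_norm_le_inv_norm_sub (w := w) (C := C * K ^ 2)
    (hH.continuous.measurable.mul ((measurable_Sker μ w).pow_const 2)).aestronglyMeasurable
    (fun z => ?_) hc.mul_right
  have h1 : ‖H z‖ ≤ C * ‖w - z‖ := by
    have := hC.dist_le_mul z w
    rwa [dist_eq_norm, dist_eq_norm, hw, sub_zero, norm_sub_rev z w] at this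
  have h2 := norm_Sker_le ha z
  calc ‖H z * Sker μ w z ^ 2‖ = ‖H z‖ * ‖Sker μ w z‖ ^ 2 := by rw [norm_mul, norm_pow]
    _ ≤ (C * ‖w - z‖) * (K * ‖w - z‖⁻¹) ^ 2 := by gcongr
    _ = C * K ^ 2 * ‖w - z‖⁻¹ := by
      rcases eq_or_ne ‖w - z‖ 0 with h | h
      · simp [h]
      · field_simp

theorem integrable_fderiv_mul_Sker {μ H : ℂ → ℂ} {w : ℂ} (ha : ‖μ w‖ < 1) (hH : ContDiff ℝ 1 H)
    (hc : HasCompactSupport H) (hw : H w = 0) (v : ℂ) :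
    Integrable fun z => fderiv ℝ (fun ζ => H ζ * Sker μ w ζ) z v := by
  have h1 : Integrable fun z => Sker μ w z * fderiv ℝ H z v :=
    integrable_Sker_mul ha ((hH.continuous_fderiv one_ne_zero).clm_apply continuous_const)
      (hc.fderiv_apply ℝ v)
  have h2 := (integrable_mul_Sker_sq ha hH hc hw).const_mul (Real.pi * beltramiCLM (μ w) v)
  refine (h1.add h2).congr ?_
  filter_upwards [(by simp [ae_iff] : ∀ᵐ z : ℂ, z ≠ w)] with z hz
  rw [fderiv_mul_Sker ha hH hz]
  rfl

theorem integrable_dZ_mul_Sker {μ H : ℂ → ℂ} {w : ℂ} (ha : ‖μ w‖ < 1) (hH : ContDiff ℝ 1 H)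
    (hc : HasCompactSupport H) (hw : H w = 0) :
    Integrable fun z => dZ (fun ζ => H ζ * Sker μ w ζ) z :=
  ((integrable_fderiv_mul_Sker ha hH hc hw 1).sub
    ((integrable_fderiv_mul_Sker ha hH hc hw I).const_mul I)).div_const 2

theorem integral_dZ_mul_Sker {μ H : ℂ → ℂ} {w : ℂ} (ha : ‖μ w‖ < 1) (hH : ContDiff ℝ 1 H)
    (hc : HasCompactSupport H) (hw : H w = 0) :
    ∫ z, dZ (fun ζ => H ζ * Sker μ w ζ) z = 0 := by
  have h1 := integrable_fderiv_mul_Sker ha hH hc hw 1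
  have h2 := integrable_fderiv_mul_Sker ha hH hc hw I
  have hd : ∀ z, z ≠ w → DifferentiableAt ℝ (fun ζ => H ζ * Sker μ w ζ) z := fun z hz =>
    ((hH.differentiable one_ne_zero) z).mul (hasFDerivAt_Sker ha hz).differentiableAt
  simp only [dZ]
  rw [integral_div, integral_sub h1 (h2.const_mul I), integral_const_mul,
    integral_fderiv_one_eq_zero hd hc.mul_right h1, integral_fderiv_I_eq_zero hd hc.mul_right h2]
  simp

theorem dZ_Sker {μ : ℂ → ℂ} {w z : ℂ} (ha : ‖μ w‖ < 1) (hz : z ≠ w) :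
    dZ (Sker μ w) z = Real.pi * Sker μ w z ^ 2 := by
  rw [dZ, (hasFDerivAt_Sker ha hz).fderiv]
  simp only [_root_.smul_apply, smul_eq_mul, beltramiCLM_apply, map_one, Complex.conj_I]
  ring_nf
  simp only [Complex.I_sq]
  ring

theorem dZbar_Sker {μ : ℂ → ℂ} {w z : ℂ} (ha : ‖μ w‖ < 1) (hz : z ≠ w) :
    dZbar (Sker μ w) z = Real.pi * μ w * Sker μ w z ^ 2 := by
  rw [dZbar, (hasFDerivAt_Sker ha hz).fderiv]
  simp only [_root_.smul_apply, smul_eq_mul, beltramiCLM_apply, map_one, Complex.conj_I]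
  ring_nf
  simp only [Complex.I_sq]
  ring

/-- **Equation (19) in Lemma 4.3 (Green's-type identity).**  For `μ ∈ C_c^∞(ℂ)` with
`‖μ‖_∞ = k < 1`, an open disk `D`, `φ ∈ C_c^∞(D)` and `w ∈ D`,
`∫_D φ(z) ∂_z̄^{μ*} S(w,z) dA(z) = φ(w) - ∫_D S(w,z)(∂_z̄ φ - μ ∂_z φ)(z) dA(z)`,
derivatives of `S` being taken in the `z`-variable. -/
theorem sker_green_identity (μ : ℂ → ℂ) (k : ℝ)
    (hμsmooth : ContDiff ℝ (⊤ : ℕ∞) μ) (hμsupp : HasCompactSupport μ)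
    (hk : k < 1) (hμk : ∀ z : ℂ, ‖μ z‖ ≤ k)
    (z₀ : ℂ) (r : ℝ) (hr : 0 < r)
    (φ : ℂ → ℂ) (hφ : ContDiff ℝ (⊤ : ℕ∞) φ) (hφc : HasCompactSupport φ)
    (hφs : tsupport φ ⊆ ball z₀ r) (w : ℂ) (hw : w ∈ ball z₀ r) :
    (∫ z in ball z₀ r,
        φ z * (dZbar (fun ζ => Sker μ w ζ) z - dZ (fun ζ => μ ζ * Sker μ w ζ) z)) =
      φ w - ∫ z in ball z₀ r, Sker μ w z * (dZbar φ z - μ z * dZ φ z) := by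
  have ha : ‖μ w‖ < 1 := (hμk w).trans_lt hk
  have hμ1 : ContDiff ℝ 1 μ := hμsmooth.of_le (by exact_mod_cast le_top)
  have hφ1 : ContDiff ℝ 1 φ := hφ.of_le (by exact_mod_cast le_top)
  have hout : ∀ z, z ∉ ball z₀ r → z ∉ tsupport φ := fun z hz h => hz (hφs h)
  rw [setIntegral_eq_integral_of_forall_compl_eq_zero fun z hz => by
      rw [image_eq_zero_of_notMem_tsupport (hout z hz), zero_mul],
    setIntegral_eq_integral_of_forall_compl_eq_zero fun z hz => by
      rw [dZ_eq_zero_of_notMem_tsupport (hout z hz), dZbar_eq_zero_of_notMem_tsupport (hout z hz)]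
      ring]
  set H : ℂ → ℂ := fun z => φ z * (μ w - μ z) with hHdef
  have hH : ContDiff ℝ 1 H := hφ1.mul (contDiff_const.sub hμ1)
  have hHc : HasCompactSupport H := hφc.mul_right
  have hHw : H w = 0 := by simp [hHdef]
  have hdZ : HasCompactSupport (dZ φ) := HasCompactSupport.intro hφc.isCompact
    fun z hz => dZ_eq_zero_of_notMem_tsupport hz
  have hdZbar : HasCompactSupport (dZbar φ) := HasCompactSupport.intro hφc.isCompact
    fun z hz => dZbar_eq_zero_of_notMem_tsupport hz
  have hcZ := continuous_dZ hφ1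
  have hcZbar := continuous_dZbar hφ1
  have hi₁ : Integrable fun z => Sker μ w z * (dZbar φ z - μ w * dZ φ z) :=
    integrable_Sker_mul ha (by fun_prop) (hdZbar.sub hdZ.mul_left)
  have hi₂ : Integrable fun z => Sker μ w z * (dZbar φ z - μ z * dZ φ z) :=
    integrable_Sker_mul ha (hcZbar.sub (hμ1.continuous.mul hcZ)) (hdZbar.sub hdZ.mul_left)
  have hi₃ := integrable_dZ_mul_Sker ha hH hHc hHw
  have hae : ∀ᵐ z : ℂ, φ z * (dZbar (fun ζ => Sker μ w ζ) z - dZ (fun ζ => μ ζ * Sker μ w ζ) z) =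
      dZ (fun ζ => H ζ * Sker μ w ζ) z + (Sker μ w z * (dZbar φ z - μ w * dZ φ z) -
        Sker μ w z * (dZbar φ z - μ z * dZ φ z)) := by
    filter_upwards [(by simp [ae_iff] : ∀ᵐ z : ℂ, z ≠ w)] with z hz
    have hS := (hasFDerivAt_Sker ha hz).differentiableAt
    have hμz := (hμ1.differentiable one_ne_zero) z
    have hφz := (hφ1.differentiable one_ne_zero) z
    have hsub : dZ (fun ζ => μ w - μ ζ) z = - dZ μ z := by
      simp only [dZ, fderiv_const_sub, _root_.neg_apply]
      ring
    rw [dZ_mul ((hH.differentiable one_ne_zero) z) hS, dZ_mul hμz hS,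
      dZ_mul hφz (hμz.const_sub _), hsub, dZ_Sker ha hz, dZbar_Sker ha hz]
    simp only [hHdef]
    ring
  rw [integral_congr_ae hae, integral_add hi₃ (by exact hi₁.sub hi₂), integral_sub hi₁ hi₂,
    integral_dZ_mul_Sker ha hH hHc hHw, integral_Sker_mul_frozen ha hφ1 hφc, zero_add]
end

section
/- Let μ ∈ C_c^∞(ℂ) with ‖μ‖_∞ = k < 1, let S(w,z) = 1/(π(w − z + μ(w)(w̄ − z̄))), let D' ⊂ D be open disks centered at a point w₀ ∈ ℂ, and let φ ∈ C_c^∞(D'). Then the function z ↦ ∫_{D'} φ(w) S(w,z) dA(w) is well-defined and C¹ on ℂ, and for almost every z ∈ ℂ: ∫_{D'} φ(w) [∂_z̄ S(w,z) − ∂_z(μ(z) S(w,z))] dA(w) = φ(z) + ∂_z̄^{μ*}( ∫_{D'} φ(w) S(w,z) dA(w) ), where all derivatives are taken in the z-variable and ∂_z̄^{μ*} h = ∂_z̄ h − ∂_z(μ h). -/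
open MeasureTheory Complex ENNReal NNReal Metric Set Filter

theorem integral_Ioo_mobius_exp {m : ℂ} (hm : ‖m‖ < 1) :
    ∫ θ in Ioo (-Real.pi) Real.pi,
      (exp (θ * I) - m * exp (-(θ * I))) / (exp (θ * I) + m * exp (-(θ * I))) =
        (2 * Real.pi : ℂ) := by
  have hne : ∀ ζ : ℂ, ‖ζ‖ ≤ 1 → 1 + m * ζ ^ 2 ≠ 0 := by
    intro ζ hζ h
    have h1 : ‖m * ζ ^ 2‖ < 1 := by
      rw [norm_mul, norm_pow]
      have : ‖ζ‖ ^ 2 ≤ 1 := pow_le_one₀ (norm_nonneg _) hζ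
      nlinarith [norm_nonneg m]
    rw [eq_neg_of_add_eq_zero_right h, norm_neg, norm_one] at h1
    exact lt_irrefl _ h1
  have hmean : Real.circleAverage (fun ζ : ℂ => (1 - m * ζ ^ 2) / (1 + m * ζ ^ 2)) 0 1 = 1 := by
    rw [circleAverage_of_differentiable_on_off_countable countable_empty]
    · simp
    · intro ζ hζ
      have := hne ζ (by simpa using hζ)
      exact ContinuousAt.continuousWithinAt (by fun_prop (disch := assumption))
    · intro ζ hζ
      have := hne ζ (le_of_lt (by simpa using hζ))
      fun_prop (disch := assumption)
  have hper : Function.Periodic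
      (fun θ : ℝ => (1 - m * circleMap 0 1 θ ^ 2) / (1 + m * circleMap 0 1 θ ^ 2))
      (2 * Real.pi) := fun θ => by simp only [periodic_circleMap 0 1 θ]
  have hint : ∫ θ in (-Real.pi)..Real.pi,
      (1 - m * circleMap 0 1 θ ^ 2) / (1 + m * circleMap 0 1 θ ^ 2) = (2 * Real.pi : ℂ) := by
    have h := hper.intervalIntegral_add_eq (-Real.pi) 0
    rw [zero_add, show -Real.pi + 2 * Real.pi = Real.pi by ring] at h
    rw [h]
    rw [Real.circleAverage, inv_smul_eq_iff₀ (by positivity)] at hmean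
    rw [hmean]; simp
  rw [← integral_Ioc_eq_integral_Ioo, ← intervalIntegral.integral_of_le (by linarith [Real.pi_pos]),
    ← hint]
  have hneg := intervalIntegral.integral_comp_neg (a := -Real.pi) (b := Real.pi)
    (fun θ : ℝ => (1 - m * circleMap 0 1 θ ^ 2) / (1 + m * circleMap 0 1 θ ^ 2))
  rw [neg_neg] at hneg
  rw [← hneg]
  refine intervalIntegral.integral_congr fun θ _ => ?_
  have he : exp (θ * I) = (circleMap 0 1 (-θ))⁻¹ := by
    simp [circleMap, ← Complex.exp_neg]
  have he' : exp (-(θ * I)) = circleMap 0 1 (-θ) := by simp [circleMap]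
  have h0 : circleMap 0 1 (-θ) ≠ 0 := circleMap_ne_center one_ne_zero
  simp only [he, he']
  rw [← mul_div_mul_right _ _ h0]
  congr 1 <;> field_simp

theorem integral_Ioi_mul_deriv_smoothTransition :
    ∫ r in Ioi (0 : ℝ), r * deriv Real.smoothTransition (r ^ 2 - 1) = 1 / 2 := by
  have hsm : ContDiff ℝ 1 Real.smoothTransition := Real.smoothTransition.contDiff (n := 1)
  have hd : ∀ r : ℝ, HasDerivAt (fun r => Real.smoothTransition (r ^ 2 - 1) / 2)
      (r * deriv Real.smoothTransition (r ^ 2 - 1)) r := fun r => by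
    have h1 := (hsm.differentiable one_ne_zero (r ^ 2 - 1)).hasDerivAt
    have h2 : HasDerivAt (fun r : ℝ => r ^ 2 - 1) (2 * r) r := by
      simpa using (hasDerivAt_pow 2 r).sub_const 1
    refine ((h1.comp r h2).div_const 2).congr_deriv ?_
    ring
  have hone : ∀ r : ℝ, 2 ≤ r → Real.smoothTransition (r ^ 2 - 1) / 2 = 1 / 2 := fun r hr => by
    rw [Real.smoothTransition.one_of_one_le (by nlinarith)]
  have hpos : ∀ r ∈ Ioi (0 : ℝ), 0 ≤ r * deriv Real.smoothTransition (r ^ 2 - 1) :=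
    fun r hr => mul_nonneg (le_of_lt hr) Real.smoothTransition.monotone.deriv_nonneg
  have hlim : Tendsto (fun r : ℝ => Real.smoothTransition (r ^ 2 - 1) / 2) atTop (nhds (1 / 2)) :=
    tendsto_const_nhds.congr' ((eventually_ge_atTop 2).mono fun r hr => (hone r hr).symm)
  rw [integral_Ioi_of_hasDerivAt_of_nonneg (hd 0).continuousAt.continuousWithinAt
    (fun r _ => hd r) hpos hlim, Real.smoothTransition.zero_of_nonpos (by norm_num)]
  norm_num

/-- The real-linear form `T ↦ ∂_z̄ T - m ∂_z T` on the space of real derivatives. -/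
noncomputable def beltramiSymbol (m : ℂ) : (ℂ →L[ℝ] ℂ) →L[ℝ] ℂ :=
  ((1 - m) / 2) • ContinuousLinearMap.apply ℝ ℂ (1 : ℂ) +
    (I * (1 + m) / 2) • ContinuousLinearMap.apply ℝ ℂ I

theorem beltramiSymbol_apply (m : ℂ) (T : ℂ →L[ℝ] ℂ) :
    beltramiSymbol m T = (1 - m) / 2 * T 1 + I * (1 + m) / 2 * T I := by
  simp [beltramiSymbol]

theorem beltramiSymbol_smul (m a : ℂ) (T : ℂ →L[ℝ] ℂ) :
    beltramiSymbol m (a • T) = a * beltramiSymbol m T := by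
  simp [beltramiSymbol_apply]; ring

/-- A smooth function vanishing on the unit disk and equal to `1` far away. -/
noncomputable def outerCutoff (v : ℂ) : ℂ := (Real.smoothTransition (‖v‖ ^ 2 - 1) : ℝ)

theorem contDiff_outerCutoff : ContDiff ℝ 1 outerCutoff := by
  have hsm : ContDiff ℝ 1 Real.smoothTransition := Real.smoothTransition.contDiff (n := 1)
  exact ofRealCLM.contDiff.comp (hsm.comp ((contDiff_norm_sq ℝ).sub contDiff_const))

theorem outerCutoff_of_norm_le {v : ℂ} (hv : ‖v‖ ≤ 1) : outerCutoff v = 0 := by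
  rw [outerCutoff, Real.smoothTransition.zero_of_nonpos (by nlinarith [norm_nonneg v]), Complex.ofReal_zero]

theorem outerCutoff_of_le_norm {v : ℂ} (hv : 2 ≤ ‖v‖) : outerCutoff v = 1 := by
  rw [outerCutoff, Real.smoothTransition.one_of_one_le (by nlinarith), Complex.ofReal_one]

theorem norm_outerCutoff_le (v : ℂ) : ‖outerCutoff v‖ ≤ 1 := by
  rw [outerCutoff, norm_real, Real.norm_of_nonneg (Real.smoothTransition.nonneg _)]
  exact Real.smoothTransition.le_one _

theorem beltramiSymbol_fderiv_outerCutoff (m v : ℂ) :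
    beltramiSymbol m (fderiv ℝ outerCutoff v) =
      (deriv Real.smoothTransition (‖v‖ ^ 2 - 1) : ℝ) * (v - m * (starRingEnd ℂ) v) := by
  have hsm : ContDiff ℝ 1 Real.smoothTransition := Real.smoothTransition.contDiff (n := 1)
  have h1 := (hsm.differentiable one_ne_zero (‖v‖ ^ 2 - 1)).hasDerivAt
  have h2 : HasFDerivAt (fun v : ℂ => ‖v‖ ^ 2 - 1) (2 • (innerSL ℝ v)) v := by
    simpa using ((hasFDerivAt_id v).norm_sq).sub_const 1
  have h3 : HasFDerivAt outerCutoff _ v :=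
    ofRealCLM.hasFDerivAt.comp v (HasDerivAt.comp_hasFDerivAt
      (f := fun v : ℂ => ‖v‖ ^ 2 - 1) (h₂ := Real.smoothTransition) v h1 h2)
  rw [h3.fderiv, beltramiSymbol_apply]
  apply Complex.ext <;> simp [Complex.inner] <;> ring

theorem integral_beltramiSymbol_fderiv_outerCutoff {m : ℂ} (hm : ‖m‖ < 1) :
    ∫ v : ℂ, beltramiSymbol m (fderiv ℝ outerCutoff v) / (v + m * (starRingEnd ℂ) v) =
      Real.pi := by
  simp_rw [beltramiSymbol_fderiv_outerCutoff]
  rw [← Complex.integral_comp_polarCoord_symm, polarCoord_target]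
  have : ∀ p ∈ Ioi (0 : ℝ) ×ˢ Ioo (-Real.pi) Real.pi,
      p.1 • (((deriv Real.smoothTransition (‖Complex.polarCoord.symm p‖ ^ 2 - 1) : ℝ) : ℂ) *
        (Complex.polarCoord.symm p - m * (starRingEnd ℂ) (Complex.polarCoord.symm p)) /
        (Complex.polarCoord.symm p + m * (starRingEnd ℂ) (Complex.polarCoord.symm p))) =
      ((p.1 * deriv Real.smoothTransition (p.1 ^ 2 - 1) : ℝ) : ℂ) *
        ((exp (p.2 * I) - m * exp (-(p.2 * I))) / (exp (p.2 * I) + m * exp (-(p.2 * I)))) := by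
    rintro ⟨r, θ⟩ ⟨hr, -⟩
    simp only [mem_Ioi] at hr
    have hr' : (r : ℂ) ≠ 0 := by exact_mod_cast hr.ne'
    have hp : Complex.polarCoord.symm (r, θ) = r * exp (θ * I) := by
      rw [Complex.polarCoord_symm_apply, exp_mul_I]; simp
    have hc : (starRingEnd ℂ) (r * exp (θ * I)) = r * exp (-(θ * I)) := by
      rw [map_mul, ← exp_conj]; simp
    have hn : ‖(r * exp (θ * I) : ℂ)‖ = r := by
      simp [norm_exp_ofReal_mul_I, abs_of_pos hr]
    rw [hp, hc, hn, real_smul, mul_div_assoc, Complex.ofReal_mul, mul_assoc]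
    congr 2
    refine Eq.trans ?_ (mul_div_mul_left _ _ hr')
    congr 1 <;> ring
  rw [setIntegral_congr_fun (measurableSet_Ioi.prod measurableSet_Ioo) this,
    Measure.volume_eq_prod,
    setIntegral_prod_mul (fun r : ℝ => ((r * deriv Real.smoothTransition (r ^ 2 - 1) : ℝ) : ℂ))
      (fun θ : ℝ => (exp (θ * I) - m * exp (-(θ * I))) / (exp (θ * I) + m * exp (-(θ * I)))),
    integral_Ioo_mobius_exp hm, integral_complex_ofReal, integral_Ioi_mul_deriv_smoothTransition]
  push_cast; ring

theorem integrable_indicator_Iio_mul_inv_norm (C R : ℝ) :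
    Integrable fun u : ℂ => (Iio R).indicator (fun r => C * r⁻¹) ‖u‖ := by
  rw [integrable_fun_norm_addHaar volume (f := (Iio R).indicator fun r => C * r⁻¹)]
  have h : IntegrableOn (fun _ : ℝ => C) (Ioo 0 R) := by
    simp
  rw [← integrable_indicator_iff measurableSet_Ioo] at h
  refine h.integrableOn.congr_fun (fun r (hr : 0 < r) => ?_) measurableSet_Ioi
  by_cases hrR : r < R
  · simp [hr, hrR]; field_simp
  · simp [hrR]

theorem integrable_of_norm_le_mul_inv {E : Type*} [NormedAddCommGroup E] {f : ℂ → E} {C R : ℝ}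
    (hf : AEStronglyMeasurable f) (hb : ∀ u, ‖f u‖ ≤ C * ‖u‖⁻¹)
    (hs : ∀ u, R ≤ ‖u‖ → f u = 0) : Integrable f := by
  refine Integrable.mono' (integrable_indicator_Iio_mul_inv_norm C R) hf (.of_forall fun u => ?_)
  by_cases hu : ‖u‖ < R
  · simpa [hu] using hb u
  · simp [hs u (not_lt.1 hu), hu]

theorem integral_fderiv_apply_eq_zero {f : ℂ → ℂ} (hf : ContDiff ℝ 1 f)
    (hc : HasCompactSupport f) (v : ℂ) : ∫ u, fderiv ℝ f u v = 0 := by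
  have hcont : Continuous fun u => fderiv ℝ f u v :=
    (hf.continuous_fderiv one_ne_zero).clm_apply continuous_const
  have hint : Integrable fun u => fderiv ℝ f u v :=
    hcont.integrable_of_hasCompactSupport (hc.fderiv_apply ℝ v)
  have h := integral_mul_fderiv_eq_neg_fderiv_mul_of_integrable (𝕜 := ℂ) (μ := volume)
    (f := fun _ : ℂ => (1 : ℂ)) (g := f) (v := v) (by simp) (by simpa using hint)
    (by simpa using hf.continuous.integrable_of_hasCompactSupport hc)
    (fun _ _ => differentiableAt_const _) (fun u _ => hf.differentiable one_ne_zero u)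
  simpa using h

theorem integrable_beltramiSymbol_fderiv (m : ℂ) {f : ℂ → ℂ} (hf : ContDiff ℝ 1 f)
    (hc : HasCompactSupport f) : Integrable fun u => beltramiSymbol m (fderiv ℝ f u) :=
  (beltramiSymbol m).integrable_comp
    ((hf.continuous_fderiv one_ne_zero).integrable_of_hasCompactSupport (hc.fderiv ℝ))

theorem integral_beltramiSymbol_fderiv_eq_zero (m : ℂ) {f : ℂ → ℂ} (hf : ContDiff ℝ 1 f)
    (hc : HasCompactSupport f) : ∫ u, beltramiSymbol m (fderiv ℝ f u) = 0 := by
  have hint := (hf.continuous_fderiv one_ne_zero).integrable_of_hasCompactSupport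
    (μ := volume) (hc.fderiv ℝ)
  rw [(beltramiSymbol m).integral_comp_comm hint, beltramiSymbol_apply,
    ContinuousLinearMap.integral_apply hint, ContinuousLinearMap.integral_apply hint,
    integral_fderiv_apply_eq_zero hf hc, integral_fderiv_apply_eq_zero hf hc]
  simp

/-- The derivative `∂_z̄ H - m ∂_z H` of a function with a singularity `c / (u + m ū)` at the
origin, integrated over the plane, only sees the singularity. -/
theorem integral_beltramiSymbol_fderiv_of_singular {m : ℂ} (hm : ‖m‖ < 1) {H : ℂ → ℂ} {c : ℂ}
    {C R : ℝ} (hH : ∀ u ≠ 0, ContDiffAt ℝ 1 H u) (hs : ∀ u, R ≤ ‖u‖ → H u = 0)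
    (hb : ∀ u, ‖H u‖ ≤ C * ‖u‖⁻¹)
    (hlim : ∀ v ≠ 0, Tendsto (fun ε : ℝ => ε • H (ε • v)) (nhdsWithin 0 (Ioi 0))
      (nhds (c / (v + m * (starRingEnd ℂ) v))))
    (hint : Integrable fun u => beltramiSymbol m (fderiv ℝ H u)) :
    ∫ u, beltramiSymbol m (fderiv ℝ H u) = -(c * Real.pi) := by
  set χ : ℝ → ℂ → ℂ := fun ε u => outerCutoff (ε⁻¹ • u)
  have hχ : ∀ ε, ContDiff ℝ 1 (χ ε) := fun ε =>
    contDiff_outerCutoff.comp (contDiff_const_smul ε⁻¹)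
  have hχ' : ∀ ε u, fderiv ℝ (χ ε) u = ε⁻¹ • fderiv ℝ outerCutoff (ε⁻¹ • u) := fun ε u => by
    rw [fderiv_comp_smul]
  have hzero : ∀ u, ‖u‖ < 1 → fderiv ℝ outerCutoff u = 0 := fun u hu => by
    have : outerCutoff =ᶠ[nhds u] fun _ => 0 := by
      filter_upwards [Metric.isOpen_ball.mem_nhds (mem_ball_zero_iff.2 hu)] with x hx
      exact outerCutoff_of_norm_le (mem_ball_zero_iff.1 hx).le
    rw [this.fderiv_eq]; simp
  have hzero' : ∀ u, 2 < ‖u‖ → fderiv ℝ outerCutoff u = 0 := fun u hu => by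
    have : outerCutoff =ᶠ[nhds u] fun _ => 1 := by
      filter_upwards [(isOpen_lt continuous_const continuous_norm).mem_nhds hu] with x hx
      exact outerCutoff_of_le_norm (le_of_lt hx)
    rw [this.fderiv_eq]; simp
  have hprodsmooth : ∀ ε : ℝ, 0 < ε → ContDiff ℝ 1 (fun u => χ ε u * H u) := by
    intro ε hε
    rw [contDiff_iff_contDiffAt]
    intro u
    by_cases hu : u = 0
    · have : (fun u => χ ε u * H u) =ᶠ[nhds u] fun _ => 0 := by
        subst hu
        filter_upwards [Metric.ball_mem_nhds (0 : ℂ) hε] with x hx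
        rw [mem_ball_zero_iff] at hx
        have : χ ε x = 0 := outerCutoff_of_norm_le (by
          rw [norm_smul, Real.norm_of_nonneg (by positivity), inv_mul_le_iff₀ hε]; linarith)
        rw [this, zero_mul]
      exact contDiffAt_const.congr_of_eventuallyEq this
    · exact (hχ ε).contDiffAt.mul (hH u hu)
  have hprodsupp : ∀ ε : ℝ, HasCompactSupport (fun u => χ ε u * H u) := fun ε =>
    HasCompactSupport.intro (isCompact_closedBall (0 : ℂ) R) fun u hu => by
      rw [hs u (by simpa using le_of_lt (not_le.1 (by simpa using hu))), mul_zero]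
  have hprod : ∀ ε : ℝ, ∀ u ≠ 0, beltramiSymbol m (fderiv ℝ (fun u => χ ε u * H u) u) =
      χ ε u * beltramiSymbol m (fderiv ℝ H u) + H u * beltramiSymbol m (fderiv ℝ (χ ε) u) := by
    intro ε u hu
    rw [fderiv_fun_mul ((hχ ε).differentiable one_ne_zero u)
      ((hH u hu).differentiableAt one_ne_zero), map_add, beltramiSymbol_smul, beltramiSymbol_smul]
  have hae : ∀ᵐ u : ℂ, u ≠ 0 := by simp [ae_iff]
  have hχint : ∀ ε, Integrable fun u => χ ε u * beltramiSymbol m (fderiv ℝ H u) := fun ε =>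
    hint.bdd_mul (hχ ε).continuous.aestronglyMeasurable
      (.of_forall fun u => norm_outerCutoff_le _)
  have hkey : ∀ ε : ℝ, 0 < ε → ∫ u, χ ε u * beltramiSymbol m (fderiv ℝ H u) =
      -∫ v, (ε • H (ε • v)) * beltramiSymbol m (fderiv ℝ outerCutoff v) := by
    intro ε hε
    have hD := integrable_beltramiSymbol_fderiv m (hprodsmooth ε hε) (hprodsupp ε)
    have h0 := integral_beltramiSymbol_fderiv_eq_zero m (hprodsmooth ε hε) (hprodsupp ε)
    have hHχ : ∫ u, H u * beltramiSymbol m (fderiv ℝ (χ ε) u) =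
        -∫ u, χ ε u * beltramiSymbol m (fderiv ℝ H u) := by
      rw [← zero_sub, ← h0, ← integral_sub hD (hχint ε)]
      refine integral_congr_ae (hae.mono fun u hu => ?_)
      simp only [hprod ε u hu]; ring
    rw [← neg_eq_iff_eq_neg, ← hHχ]
    have hsub := Measure.integral_comp_smul_of_nonneg volume
      (fun u => H u * beltramiSymbol m (fderiv ℝ (χ ε) u)) ε (hR := hε.le)
    rw [eq_comm, inv_smul_eq_iff₀ (by positivity), ← integral_smul] at hsub
    rw [hsub]
    refine integral_congr_ae (.of_forall fun v => ?_)
    simp only [hχ', map_smul, finrank_real_complex, real_smul,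
      Complex.ofReal_pow, Complex.ofReal_inv]
    have : (ε : ℂ) ≠ 0 := by exact_mod_cast hε.ne'
    field_simp
  have hpos : ∀ᶠ ε : ℝ in nhdsWithin 0 (Ioi 0), 0 < ε := self_mem_nhdsWithin
  have hC : 0 ≤ C := by simpa using (norm_nonneg _).trans (hb 1)
  have hlim1 : Tendsto (fun ε : ℝ => ∫ u, χ ε u * beltramiSymbol m (fderiv ℝ H u))
      (nhdsWithin 0 (Ioi 0)) (nhds (∫ u, beltramiSymbol m (fderiv ℝ H u))) := by
    refine tendsto_integral_filter_of_dominated_convergence _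
      (.of_forall fun ε => (hχint ε).aestronglyMeasurable)
      (.of_forall fun ε => .of_forall fun u => ?_) hint.norm (hae.mono fun u hu => ?_)
    · rw [norm_mul]
      exact mul_le_of_le_one_left (norm_nonneg _) (norm_outerCutoff_le _)
    · refine tendsto_const_nhds.congr' ?_
      have : 0 < ‖u‖ / 2 := by positivity
      filter_upwards [hpos, nhdsWithin_le_nhds (Iio_mem_nhds this)] with ε hε hεu
      have : χ ε u = 1 := outerCutoff_of_le_norm (by
        rw [norm_smul, Real.norm_of_nonneg (by positivity), le_inv_mul_iff₀ hε]
        rw [mem_Iio] at hεu; linarith)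
      rw [this, one_mul]
  have hlim2 : Tendsto
      (fun ε : ℝ => ∫ v, (ε • H (ε • v)) * beltramiSymbol m (fderiv ℝ outerCutoff v))
      (nhdsWithin 0 (Ioi 0)) (nhds (∫ v, c / (v + m * (starRingEnd ℂ) v) *
        beltramiSymbol m (fderiv ℝ outerCutoff v))) := by
    have hcont : Continuous fun v => beltramiSymbol m (fderiv ℝ outerCutoff v) :=
      (beltramiSymbol m).continuous.comp (contDiff_outerCutoff.continuous_fderiv one_ne_zero)
    have hHm : Measurable H := by
      refine measurable_of_continuousOn_compl_singleton 0 fun u hu => ?_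
      exact (hH u hu).continuousAt.continuousWithinAt
    refine tendsto_integral_filter_of_dominated_convergence
      (fun v => C * ‖beltramiSymbol m (fderiv ℝ outerCutoff v)‖)
      (.of_forall fun ε => ?_) (hpos.mono fun ε hε => .of_forall fun v => ?_)
      ?_ (hae.mono fun v hv => ?_)
    · exact (((hHm.comp (measurable_const_smul ε)).const_smul ε).mul
        hcont.measurable).aestronglyMeasurable
    · rw [norm_mul]
      by_cases hv : ‖v‖ < 1
      · simp [hzero v hv]
      · gcongr
        have hv' : 0 < ‖v‖ := by linarith
        calc ‖ε • H (ε • v)‖ ≤ ε * (C * ‖ε • v‖⁻¹) := by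
              rw [norm_smul, Real.norm_of_nonneg hε.le]; gcongr; exact hb _
          _ = C * ‖v‖⁻¹ := by
              rw [norm_smul, Real.norm_of_nonneg hε.le]; field_simp
          _ ≤ C := mul_le_of_le_one_right hC (inv_le_one_of_one_le₀ (not_lt.1 hv))
    · refine (hcont.integrable_of_hasCompactSupport ?_).norm.const_mul C
      refine HasCompactSupport.intro (isCompact_closedBall (0 : ℂ) 2) fun u hu => ?_
      rw [hzero' u (by simpa using hu), map_zero]
    · exact (hlim v hv).mul_const _
  have heq := tendsto_nhds_unique hlim1
    (hlim2.neg.congr' (hpos.mono fun ε hε => (hkey ε hε).symm))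
  rw [heq, ← integral_beltramiSymbol_fderiv_outerCutoff hm, ← integral_const_mul]
  congr 1
  refine integral_congr_ae (.of_forall fun v => ?_)
  simp only; ring

theorem contDiff_one_integral_translate {A : ℂ → ℂ → ℂ} {A' : ℂ → ℂ → (ℂ →L[ℝ] ℂ)} {C M : ℝ}
    (hd : ∀ u ≠ 0, ∀ w, HasFDerivAt (fun w => A w u) (A' w u) w)
    (hcont : ∀ u ≠ 0, Continuous fun w => A' w u)
    (hA : ∀ z, Integrable fun u => A (z + u) u)
    (hmeas : ∀ z, AEStronglyMeasurable fun u => A' (z + u) u)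
    (hb : ∀ w u, ‖A' w u‖ ≤ C * ‖u‖⁻¹) (hs : ∀ w u, M ≤ ‖w‖ → A' w u = 0) :
    (∀ z, HasFDerivAt (fun z => ∫ u, A (z + u) u) (∫ u, A' (z + u) u) z) ∧
      Continuous fun z => ∫ u, A' (z + u) u := by
  have hae : ∀ᵐ u : ℂ, u ≠ 0 := by simp [ae_iff]
  have hbound : ∀ z₀ : ℂ, ∀ u : ℂ, ∀ z ∈ ball z₀ 1,
      ‖A' (z + u) u‖ ≤ (Iio (M + ‖z₀‖ + 1)).indicator (fun r => C * r⁻¹) ‖u‖ := by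
    intro z₀ u z hz
    by_cases hu : ‖u‖ < M + ‖z₀‖ + 1
    · simpa [hu] using hb (z + u) u
    · have h1 : ‖z‖ ≤ ‖z₀‖ + 1 := by
        have := norm_le_norm_add_norm_sub' z z₀
        rw [mem_ball_iff_norm] at hz
        linarith
      have h2 := norm_le_norm_add_norm_sub' u (-z)
      rw [sub_neg_eq_add, norm_neg, add_comm u z] at h2
      rw [hs (z + u) u (by linarith)]
      simp [hu]
  have htrans : ∀ u : ℂ, ∀ z : ℂ, HasFDerivAt (fun z : ℂ => z + u) (.id ℝ ℂ) z := fun u z =>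
    (hasFDerivAt_id z).add_const u
  refine ⟨fun z₀ => ?_, continuous_iff_continuousAt.2 fun z₀ => ?_⟩
  · refine hasFDerivAt_integral_of_dominated_of_fderiv_le (ball_mem_nhds z₀ one_pos)
      (.of_forall fun z => (hA z).aestronglyMeasurable) (hA z₀) (hmeas z₀)
      (.of_forall fun u => hbound z₀ u) (integrable_indicator_Iio_mul_inv_norm C _)
      (hae.mono fun u hu z _ => ?_)
    exact ((hd u hu (z + u)).comp z (htrans u z)).congr_fderiv (ContinuousLinearMap.comp_id _)
  · refine continuousAt_of_dominated (.of_forall hmeas)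
      ((eventually_mem_set.2 (ball_mem_nhds z₀ one_pos)).mono fun z hz =>
        .of_forall fun u => hbound z₀ u z hz)
      (integrable_indicator_Iio_mul_inv_norm C _) (hae.mono fun u hu => ?_)
    exact ((hcont u hu).comp (continuous_add_const u)).continuousAt

theorem dZbar_sub_dZ_mul {μ f : ℂ → ℂ} {z : ℂ} (hμ : DifferentiableAt ℝ μ z)
    (hf : DifferentiableAt ℝ f z) :
    dZbar f z - dZ (fun ζ => μ ζ * f ζ) z =
      beltramiSymbol (μ z) (fderiv ℝ f z) - f z * dZ μ z := by
  simp only [dZbar, dZ, fderiv_fun_mul hμ hf, beltramiSymbol_apply, _root_.add_apply,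
    _root_.smul_apply, smul_eq_mul]
  ring

theorem beltramiSymbol_id_add_smul_conj (m a : ℂ) :
    beltramiSymbol m (.id ℝ ℂ + a • (conjCLE : ℂ →L[ℝ] ℂ)) = a - m := by
  rw [beltramiSymbol_apply]
  simp
  linear_combination (1 + m) / 2 * (1 - a) * I_mul_I

section Kernel

variable {μ φ : ℂ → ℂ} {k : ℝ}

/-- The kernel `φ(w) / (u + μ(w) ū)`, which is `π φ(w) S(w, w - u)`. -/
noncomputable def beltramiKernel (μ φ : ℂ → ℂ) (w u : ℂ) : ℂ :=
  φ w * (u + μ w * (starRingEnd ℂ) u)⁻¹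

/-- The derivative of `beltramiKernel μ φ w u` in `w`. -/
noncomputable def beltramiKernelDeriv (μ φ : ℂ → ℂ) (w u : ℂ) : ℂ →L[ℝ] ℂ :=
  (u + μ w * (starRingEnd ℂ) u)⁻¹ • fderiv ℝ φ w -
    (φ w * (starRingEnd ℂ) u * ((u + μ w * (starRingEnd ℂ) u) ^ 2)⁻¹) • fderiv ℝ μ w

theorem mul_norm_le_norm_add_mul_conj {a : ℂ} (ha : ‖a‖ ≤ k) (u : ℂ) :
    (1 - k) * ‖u‖ ≤ ‖u + a * (starRingEnd ℂ) u‖ := by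
  have h := norm_sub_le_norm_add u (a * (starRingEnd ℂ) u)
  rw [norm_mul, RCLike.norm_conj] at h
  nlinarith [norm_nonneg u]

theorem add_mul_conj_ne_zero {a : ℂ} (ha : ‖a‖ ≤ k) (hk : k < 1) {u : ℂ} (hu : u ≠ 0) :
    u + a * (starRingEnd ℂ) u ≠ 0 := by
  rw [← norm_pos_iff] at hu ⊢
  exact lt_of_lt_of_le (mul_pos (by linarith) hu) (mul_norm_le_norm_add_mul_conj ha u)

theorem norm_inv_add_mul_conj_le {a : ℂ} (ha : ‖a‖ ≤ k) (hk : k < 1) (u : ℂ) :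
    ‖(u + a * (starRingEnd ℂ) u)⁻¹‖ ≤ (1 - k)⁻¹ * ‖u‖⁻¹ := by
  by_cases hu : u = 0
  · simp [hu]
  · have : 0 < ‖u‖ := norm_pos_iff.2 hu
    have hk' : 0 < 1 - k := by linarith
    rw [norm_inv, ← mul_inv]
    exact inv_anti₀ (by positivity) (mul_norm_le_norm_add_mul_conj ha u)

theorem norm_mul_inv_sq_add_mul_conj_le {a b : ℂ} {L : ℝ} (ha : ‖a‖ ≤ k) (hk : k < 1) {u : ℂ}
    (hb : ‖b‖ ≤ L * ‖u‖) :
    ‖b * ((u + a * (starRingEnd ℂ) u) ^ 2)⁻¹‖ ≤ L * (1 - k)⁻¹ ^ 2 * ‖u‖⁻¹ := by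
  by_cases hu : u = 0
  · simp [hu]
  · have : 0 < ‖u‖ := norm_pos_iff.2 hu
    have hL : 0 ≤ L * ‖u‖ := (norm_nonneg _).trans hb
    rw [norm_mul, ← inv_pow, norm_pow]
    calc ‖b‖ * ‖(u + a * (starRingEnd ℂ) u)⁻¹‖ ^ 2 ≤ L * ‖u‖ * ((1 - k)⁻¹ * ‖u‖⁻¹) ^ 2 := by
          gcongr; exact norm_inv_add_mul_conj_le ha hk u
      _ = L * (1 - k)⁻¹ ^ 2 * ‖u‖⁻¹ := by field_simp

theorem hasFDerivAt_beltramiKernel (hμ : ContDiff ℝ 1 μ) (hφ : ContDiff ℝ 1 φ) (hk : k < 1)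
    (hμk : ∀ z, ‖μ z‖ ≤ k) {u : ℂ} (hu : u ≠ 0) (w : ℂ) :
    HasFDerivAt (fun w => beltramiKernel μ φ w u) (beltramiKernelDeriv μ φ w u) w := by
  have hq := add_mul_conj_ne_zero (hμk w) hk hu
  have h1 := (hφ.differentiable one_ne_zero w).hasFDerivAt
  have h2 := (((hμ.differentiable one_ne_zero w).hasFDerivAt).mul_const
    ((starRingEnd ℂ) u)).const_add u
  refine (h1.mul ((hasDerivAt_inv hq).comp_hasFDerivAt w h2)).congr_fderiv ?_
  ext
  all_goals
    simp [beltramiKernelDeriv]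
    ring

theorem hasFDerivAt_beltramiKernel_translate (hμ : ContDiff ℝ 1 μ) (hφ : ContDiff ℝ 1 φ)
    (hk : k < 1) (hμk : ∀ z, ‖μ z‖ ≤ k) (z : ℂ) {u : ℂ} (hu : u ≠ 0) :
    HasFDerivAt (fun u => beltramiKernel μ φ (z + u) u)
      (beltramiKernelDeriv μ φ (z + u) u -
        (φ (z + u) * ((u + μ (z + u) * (starRingEnd ℂ) u) ^ 2)⁻¹) •
          (.id ℝ ℂ + μ (z + u) • (conjCLE : ℂ →L[ℝ] ℂ))) u := by
  have hq := add_mul_conj_ne_zero (hμk (z + u)) hk hu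
  have ht : HasFDerivAt (fun u : ℂ => z + u) (.id ℝ ℂ) u := (hasFDerivAt_id u).const_add z
  have h1 := ((hφ.differentiable one_ne_zero (z + u)).hasFDerivAt).comp u ht
  have h2 := (hasFDerivAt_id u).add ((((hμ.differentiable one_ne_zero (z + u)).hasFDerivAt).comp
    u ht).mul (conjCLE : ℂ →L[ℝ] ℂ).hasFDerivAt)
  refine (h1.mul ((hasDerivAt_inv hq).comp_hasFDerivAt u h2)).congr_fderiv ?_
  ext
  all_goals
    simp [beltramiKernelDeriv]
    ring

theorem continuous_beltramiKernelDeriv (hμ : ContDiff ℝ 1 μ) (hφ : ContDiff ℝ 1 φ) (hk : k < 1)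
    (hμk : ∀ z, ‖μ z‖ ≤ k) {u : ℂ} (hu : u ≠ 0) :
    Continuous fun w => beltramiKernelDeriv μ φ w u := by
  have hq : ∀ w, u + μ w * (starRingEnd ℂ) u ≠ 0 := fun w => add_mul_conj_ne_zero (hμk w) hk hu
  have hq2 : ∀ w, (u + μ w * (starRingEnd ℂ) u) ^ 2 ≠ 0 := fun w => pow_ne_zero 2 (hq w)
  have h1 := hμ.continuous_fderiv one_ne_zero
  have h2 := hφ.continuous_fderiv one_ne_zero
  have h3 := hμ.continuous
  have h4 := hφ.continuous
  unfold beltramiKernelDeriv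
  fun_prop (disch := assumption)

theorem stronglyMeasurable_beltramiKernelDeriv (hμ : ContDiff ℝ 1 μ) (hφ : ContDiff ℝ 1 φ)
    (z : ℂ) : StronglyMeasurable fun u => beltramiKernelDeriv μ φ (z + u) u := by
  have h1 : Continuous fun u => fderiv ℝ μ (z + u) :=
    (hμ.continuous_fderiv one_ne_zero).comp (continuous_const_add z)
  have h2 : Continuous fun u => fderiv ℝ φ (z + u) :=
    (hφ.continuous_fderiv one_ne_zero).comp (continuous_const_add z)
  have h3 : Continuous fun u => μ (z + u) := hμ.continuous.comp (continuous_const_add z)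
  have h4 : Continuous fun u => φ (z + u) := hφ.continuous.comp (continuous_const_add z)
  have hq : Continuous fun u => u + μ (z + u) * (starRingEnd ℂ) u := by fun_prop
  have hn : Continuous fun u => φ (z + u) * (starRingEnd ℂ) u := by fun_prop
  exact (hq.measurable.inv.stronglyMeasurable.smul h2.stronglyMeasurable).sub
    ((hn.measurable.mul (hq.pow 2).measurable.inv).stronglyMeasurable.smul h1.stronglyMeasurable)

theorem contDiffAt_beltramiKernel_translate (hμ : ContDiff ℝ 1 μ) (hφ : ContDiff ℝ 1 φ)
    (hk : k < 1) (hμk : ∀ z, ‖μ z‖ ≤ k) (z : ℂ) {u : ℂ} (hu : u ≠ 0) :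
    ContDiffAt ℝ 1 (fun u => beltramiKernel μ φ (z + u) u) u := by
  have hq := add_mul_conj_ne_zero (hμk (z + u)) hk hu
  have hc : ContDiff ℝ 1 (fun u : ℂ => (starRingEnd ℂ) u) := conjCLE.contDiff
  have ht : ContDiff ℝ 1 (fun u : ℂ => z + u) := contDiff_const.add contDiff_id
  exact (hφ.comp ht).contDiffAt.mul
    ((contDiff_id.add ((hμ.comp ht).mul hc)).contDiffAt.inv hq)

theorem tendsto_smul_beltramiKernel_smul (hμ : Continuous μ) (hφ : Continuous φ) (hk : k < 1)
    (hμk : ∀ z, ‖μ z‖ ≤ k) (z : ℂ) {v : ℂ} (hv : v ≠ 0) :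
    Tendsto (fun ε : ℝ => ε • beltramiKernel μ φ (z + ε • v) (ε • v)) (nhdsWithin 0 (Ioi 0))
      (nhds (φ z / (v + μ z * (starRingEnd ℂ) v))) := by
  have hcont : ContinuousAt (fun ε : ℝ => φ (z + ε • v) /
      (v + μ (z + ε • v) * (starRingEnd ℂ) v)) 0 := by
    refine ContinuousAt.div (by fun_prop) (by fun_prop) ?_
    exact add_mul_conj_ne_zero (hμk _) hk hv
  have h := hcont.tendsto.mono_left (nhdsWithin_le_nhds (s := Ioi 0))
  simp only [zero_smul, add_zero] at h
  refine h.congr' (eventually_mem_nhdsWithin.mono fun ε hε => ?_)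
  have hε' : (ε : ℂ) ≠ 0 := by exact_mod_cast (ne_of_gt hε)
  simp only [beltramiKernel, real_smul, map_mul, conj_ofReal]
  rw [show ε * v + μ (z + ε * v) * (ε * (starRingEnd ℂ) v) =
    ε * (v + μ (z + ε * v) * (starRingEnd ℂ) v) by ring, mul_inv]
  field_simp

theorem stronglyMeasurable_beltramiKernel (hμ : Continuous μ) (hφ : Continuous φ) (z : ℂ) :
    StronglyMeasurable fun u => beltramiKernel μ φ (z + u) u := by
  have hq : Continuous fun u => u + μ (z + u) * (starRingEnd ℂ) u := by fun_prop
  have hn : Continuous fun u => φ (z + u) := by fun_prop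
  exact (hn.measurable.mul hq.measurable.inv).stronglyMeasurable

theorem exists_norm_beltramiKernel_le (hφ : Continuous φ) (hφc : HasCompactSupport φ)
    (hk : k < 1) (hμk : ∀ z, ‖μ z‖ ≤ k) :
    ∃ C, ∀ w u, ‖beltramiKernel μ φ w u‖ ≤ C * ‖u‖⁻¹ := by
  obtain ⟨C, hC⟩ := hφ.bounded_above_of_compact_support hφc
  refine ⟨C * (1 - k)⁻¹, fun w u => ?_⟩
  rw [beltramiKernel, norm_mul, mul_assoc]
  exact mul_le_mul (hC w) (norm_inv_add_mul_conj_le (hμk w) hk u) (norm_nonneg _)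
    ((norm_nonneg _).trans (hC w))

theorem exists_norm_beltramiKernelDeriv_le (hμ : ContDiff ℝ 1 μ) (hμc : HasCompactSupport μ)
    (hφ : ContDiff ℝ 1 φ) (hφc : HasCompactSupport φ) (hk : k < 1) (hμk : ∀ z, ‖μ z‖ ≤ k) :
    ∃ C, ∀ w u, ‖beltramiKernelDeriv μ φ w u‖ ≤ C * ‖u‖⁻¹ := by
  obtain ⟨C, hC⟩ := hφ.continuous.bounded_above_of_compact_support hφc
  obtain ⟨C₁, hC₁⟩ := (hφ.continuous_fderiv one_ne_zero).bounded_above_of_compact_support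
    (hφc.fderiv ℝ)
  obtain ⟨C₂, hC₂⟩ := (hμ.continuous_fderiv one_ne_zero).bounded_above_of_compact_support
    (hμc.fderiv ℝ)
  refine ⟨(1 - k)⁻¹ * C₁ + C * (1 - k)⁻¹ ^ 2 * C₂, fun w u => (norm_sub_le _ _).trans ?_⟩
  have h1 := norm_inv_add_mul_conj_le (hμk w) hk u
  have h2 : ‖φ w * (starRingEnd ℂ) u‖ ≤ C * ‖u‖ := by
    rw [norm_mul, RCLike.norm_conj]
    exact mul_le_mul_of_nonneg_right (hC w) (norm_nonneg u)
  have h3 := norm_mul_inv_sq_add_mul_conj_le (hμk w) hk h2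
  rw [norm_smul, norm_smul]
  calc _ ≤ (1 - k)⁻¹ * ‖u‖⁻¹ * C₁ + C * (1 - k)⁻¹ ^ 2 * ‖u‖⁻¹ * C₂ :=
        add_le_add (mul_le_mul h1 (hC₁ w) (norm_nonneg _) ((norm_nonneg _).trans h1))
          (mul_le_mul h3 (hC₂ w) (norm_nonneg _) ((norm_nonneg _).trans h3))
    _ = _ := by ring

theorem exists_le_norm_imp_eq_zero (hφc : HasCompactSupport φ) :
    ∃ M, ∀ w, M ≤ ‖w‖ → φ w = 0 ∧ fderiv ℝ φ w = 0 := by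
  obtain ⟨M, hM⟩ := (hφc.isCompact : IsCompact (tsupport φ)).isBounded.exists_norm_le
  refine ⟨M + 1, fun w hw => ?_⟩
  have hnot : w ∉ tsupport φ := fun h => by linarith [hM w h]
  exact ⟨image_eq_zero_of_notMem_tsupport hnot, fderiv_of_notMem_tsupport ℝ hnot⟩

theorem integrable_beltramiKernel_translate (hμ : Continuous μ) (hφ : Continuous φ)
    (hφc : HasCompactSupport φ) (hk : k < 1) (hμk : ∀ z, ‖μ z‖ ≤ k) (z : ℂ) :
    Integrable fun u => beltramiKernel μ φ (z + u) u := by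
  obtain ⟨C, hC⟩ := exists_norm_beltramiKernel_le hφ hφc hk hμk
  obtain ⟨M, hM⟩ := exists_le_norm_imp_eq_zero hφc
  refine integrable_of_norm_le_mul_inv (R := M + ‖z‖)
    (stronglyMeasurable_beltramiKernel hμ hφ z).aestronglyMeasurable
    (fun u => hC (z + u) u) fun u hu => ?_
  rw [beltramiKernel, (hM (z + u) ?_).1, zero_mul]
  linarith [norm_sub_le_norm_add u z, add_comm u z ▸ norm_sub_le_norm_add u z]

theorem integrable_beltramiKernelDeriv_translate (hμ : ContDiff ℝ 1 μ)
    (hμc : HasCompactSupport μ) (hφ : ContDiff ℝ 1 φ) (hφc : HasCompactSupport φ) (hk : k < 1)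
    (hμk : ∀ z, ‖μ z‖ ≤ k) (z : ℂ) :
    Integrable fun u => beltramiKernelDeriv μ φ (z + u) u := by
  obtain ⟨C, hC⟩ := exists_norm_beltramiKernelDeriv_le hμ hμc hφ hφc hk hμk
  obtain ⟨M, hM⟩ := exists_le_norm_imp_eq_zero hφc
  refine integrable_of_norm_le_mul_inv (R := M + ‖z‖)
    (stronglyMeasurable_beltramiKernelDeriv hμ hφ z).aestronglyMeasurable
    (fun u => hC (z + u) u) fun u hu => ?_
  have hw : M ≤ ‖z + u‖ := by
    linarith [norm_sub_le_norm_add u z, add_comm u z ▸ norm_sub_le_norm_add u z]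
  simp [beltramiKernelDeriv, hM _ hw]

theorem integrable_mul_sub_mul_inv_sq (hμ : ContDiff ℝ 1 μ) (hμc : HasCompactSupport μ)
    (hφ : Continuous φ) (hφc : HasCompactSupport φ) (hk : k < 1) (hμk : ∀ z, ‖μ z‖ ≤ k) (z : ℂ) :
    Integrable fun u => φ (z + u) * (μ (z + u) - μ z) *
      ((u + μ (z + u) * (starRingEnd ℂ) u) ^ 2)⁻¹ := by
  obtain ⟨C, hC⟩ := hφ.bounded_above_of_compact_support hφc
  obtain ⟨M, hM⟩ := exists_le_norm_imp_eq_zero hφc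
  obtain ⟨L, hL⟩ := hμ.lipschitzWith_of_hasCompactSupport hμc one_ne_zero
  have hμ' := hμ.continuous
  refine integrable_of_norm_le_mul_inv (C := C * L * (1 - k)⁻¹ ^ 2) (R := M + ‖z‖) ?_
    (fun u => norm_mul_inv_sq_add_mul_conj_le (hμk _) hk ?_) fun u hu => ?_
  · have hq : Continuous fun u => (u + μ (z + u) * (starRingEnd ℂ) u) ^ 2 := by fun_prop
    have hn : Continuous fun u => φ (z + u) * (μ (z + u) - μ z) := by fun_prop
    exact (hn.measurable.mul hq.measurable.inv).aestronglyMeasurable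
  · rw [norm_mul, mul_assoc]
    refine mul_le_mul (hC _) ?_ (norm_nonneg _) ((norm_nonneg _).trans (hC 0))
    simpa using hL.norm_sub_le (z + u) z
  · rw [(hM (z + u) ?_).1, zero_mul, zero_mul]
    linarith [norm_sub_le_norm_add u z, add_comm u z ▸ norm_sub_le_norm_add u z]

/-- The contribution of the diagonal singularity of the kernel is `π φ(z)`. -/
theorem integral_mul_sub_mul_inv_sq (hμ : ContDiff ℝ 1 μ) (hμc : HasCompactSupport μ)
    (hφ : ContDiff ℝ 1 φ) (hφc : HasCompactSupport φ) (hk : k < 1) (hμk : ∀ z, ‖μ z‖ ≤ k)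
    (z : ℂ) :
    ∫ u, φ (z + u) * (μ (z + u) - μ z) * ((u + μ (z + u) * (starRingEnd ℂ) u) ^ 2)⁻¹ =
      φ z * Real.pi + beltramiSymbol (μ z) (∫ u, beltramiKernelDeriv μ φ (z + u) u) := by
  have hae : ∀ᵐ u : ℂ, u ≠ 0 := by simp [ae_iff]
  have hT := integrable_mul_sub_mul_inv_sq hμ hμc hφ.continuous hφc hk hμk z
  have hK := integrable_beltramiKernelDeriv_translate hμ hμc hφ hφc hk hμk z
  have hΛ := (beltramiSymbol (μ z)).integrable_comp hK
  have hfd : (fun u => beltramiSymbol (μ z) (fderiv ℝ (fun u => beltramiKernel μ φ (z + u) u) u))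
      =ᵐ[volume] fun u => beltramiSymbol (μ z) (beltramiKernelDeriv μ φ (z + u) u) -
        φ (z + u) * (μ (z + u) - μ z) * ((u + μ (z + u) * (starRingEnd ℂ) u) ^ 2)⁻¹ := by
    filter_upwards [hae] with u hu
    rw [(hasFDerivAt_beltramiKernel_translate hμ hφ hk hμk z hu).fderiv, map_sub,
      beltramiSymbol_smul, beltramiSymbol_id_add_smul_conj]
    ring
  obtain ⟨C, hC⟩ := exists_norm_beltramiKernel_le hφ.continuous hφc hk hμk
  obtain ⟨M, hM⟩ := exists_le_norm_imp_eq_zero hφc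
  have h := integral_beltramiSymbol_fderiv_of_singular ((hμk z).trans_lt hk) (R := M + ‖z‖)
    (fun u hu => contDiffAt_beltramiKernel_translate hμ hφ hk hμk z hu)
    (fun u hu => by
      rw [beltramiKernel, (hM (z + u) ?_).1, zero_mul]
      linarith [norm_sub_le_norm_add u z, add_comm u z ▸ norm_sub_le_norm_add u z])
    (fun u => hC (z + u) u)
    (fun v hv => tendsto_smul_beltramiKernel_smul hμ.continuous hφ.continuous hk hμk z hv)
    ((hΛ.sub hT).congr hfd.symm)
  rw [integral_congr_ae hfd, integral_sub hΛ hT,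
    (beltramiSymbol (μ z)).integral_comp_comm hK] at h
  linear_combination -h

theorem mul_Sker_add (w u : ℂ) :
    φ (w + u) * Sker μ (w + u) w = (Real.pi : ℂ)⁻¹ * beltramiKernel μ φ (w + u) u := by
  rw [Sker, beltramiKernel, map_add, add_sub_cancel_left, add_sub_cancel_left, one_div, mul_inv]
  ring

theorem hasFDerivAt_Sker_s15 (hk : k < 1) (hμk : ∀ z, ‖μ z‖ ≤ k) (z : ℂ) {u : ℂ} (hu : u ≠ 0) :
    HasFDerivAt (fun ζ => Sker μ (z + u) ζ)
      (((Real.pi : ℂ)⁻¹ * ((u + μ (z + u) * (starRingEnd ℂ) u) ^ 2)⁻¹) •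
        (.id ℝ ℂ + μ (z + u) • (conjCLE : ℂ →L[ℝ] ℂ))) z := by
  set w := z + u
  have hq : w - z + μ w * ((starRingEnd ℂ) w - (starRingEnd ℂ) z) ≠ 0 := by
    rw [← map_sub]
    exact add_mul_conj_ne_zero (hμk w) hk (by simpa [w] using hu)
  have h1 := ((hasFDerivAt_id z).const_sub w).add
    (((conjCLE : ℂ →L[ℝ] ℂ).hasFDerivAt.const_sub ((starRingEnd ℂ) w)).const_mul (μ w))
  have h2 := ((hasDerivAt_inv hq).comp_hasFDerivAt z h1).const_mul ((Real.pi : ℂ)⁻¹)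
  have hfun : (fun ζ => Sker μ w ζ) = fun ζ => (Real.pi : ℂ)⁻¹ *
      (w - ζ + μ w * ((starRingEnd ℂ) w - (starRingEnd ℂ) ζ))⁻¹ := by
    ext ζ
    rw [Sker, one_div, mul_inv]
  rw [hfun]
  refine h2.congr_fderiv ?_
  ext
  all_goals
    simp [w]
    ring

end Kernel

/-- **Lemma 4.3 (Green's-theorem-type statement for `S`).**  For `μ ∈ C_c^∞(ℂ)` with
`‖μ‖_∞ = k < 1`, disks `D' ⊆ D` centered at `w₀` and `φ ∈ C_c^∞(D')`, the function
`z ↦ ∫_{D'} φ(w) S(w,z) dA(w)` is well-defined and `C¹`, and for a.e. `z`,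
`∫_{D'} φ(w) ∂_z̄^{μ*}S(w,z) dA(w) = φ(z) + ∂_z̄^{μ*}(∫_{D'} φ(w) S(w,z) dA(w))`,
where all derivatives are in the `z`-variable and `∂_z̄^{μ*}h = ∂_z̄ h - ∂_z(μ h)`. -/
theorem sker_green_lemma (μ : ℂ → ℂ) (k : ℝ)
    (hμsmooth : ContDiff ℝ (⊤ : ℕ∞) μ) (hμsupp : HasCompactSupport μ)
    (hk : k < 1) (hμk : ∀ z : ℂ, ‖μ z‖ ≤ k)
    (w₀ : ℂ) (r' r : ℝ) (hr' : 0 < r') (hrr : r' ≤ r)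
    (φ : ℂ → ℂ) (hφ : ContDiff ℝ (⊤ : ℕ∞) φ) (hφc : HasCompactSupport φ)
    (hφs : tsupport φ ⊆ ball w₀ r') :
    (∀ z : ℂ, IntegrableOn (fun w => φ w * Sker μ w z) (ball w₀ r') volume) ∧
    ContDiff ℝ 1 (fun z => ∫ w in ball w₀ r', φ w * Sker μ w z) ∧
    ∀ᵐ z : ℂ,
      (∫ w in ball w₀ r',
          φ w * (dZbar (fun ζ => Sker μ w ζ) z - dZ (fun ζ => μ ζ * Sker μ w ζ) z)) =
        φ z +
          (dZbar (fun ζ => ∫ w in ball w₀ r', φ w * Sker μ w ζ) z -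
            dZ (fun ζ => μ ζ * ∫ w in ball w₀ r', φ w * Sker μ w ζ) z) := by
  have hμ : ContDiff ℝ 1 μ := hμsmooth.of_le (by norm_cast)
  have hφ1 : ContDiff ℝ 1 φ := hφ.of_le (by norm_cast)
  have hae : ∀ᵐ u : ℂ, u ≠ 0 := by simp [ae_iff]
  have hball : ∀ (z : ℂ) (g : ℂ → ℂ),
      ∫ w in ball w₀ r', φ w * g w = ∫ u, φ (z + u) * g (z + u) := fun z g => by
    rw [setIntegral_eq_integral_of_forall_compl_eq_zero fun w hw => ?_,
      ← integral_add_left_eq_self _ z]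
    rw [image_eq_zero_of_notMem_tsupport fun h => hw (hφs h), zero_mul]
  have hK := integrable_beltramiKernel_translate hμ.continuous hφ1.continuous hφc hk hμk
  have hF : (fun z => ∫ w in ball w₀ r', φ w * Sker μ w z) =
      fun z => (Real.pi : ℂ)⁻¹ * ∫ u, beltramiKernel μ φ (z + u) u := by
    ext z
    rw [hball z fun w => Sker μ w z, ← integral_const_mul]
    simp only [mul_Sker_add]
  obtain ⟨C, hC⟩ := exists_norm_beltramiKernelDeriv_le hμ hμsupp hφ1 hφc hk hμk
  obtain ⟨M, hM⟩ := exists_le_norm_imp_eq_zero hφc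
  obtain ⟨hderiv, hcont⟩ := contDiff_one_integral_translate
    (fun u hu w => hasFDerivAt_beltramiKernel hμ hφ1 hk hμk hu w)
    (fun u hu => continuous_beltramiKernelDeriv hμ hφ1 hk hμk hu) hK
    (fun z => (stronglyMeasurable_beltramiKernelDeriv hμ hφ1 z).aestronglyMeasurable) hC
    (M := M) (fun w u hw => by simp [beltramiKernelDeriv, hM w hw])
  refine ⟨fun z => Integrable.integrableOn ?_, ?_, .of_forall fun z => ?_⟩
  · have h := ((hK z).const_mul (Real.pi : ℂ)⁻¹).comp_add_left (-z)
    refine h.congr (.of_forall fun w => ?_)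
    simpa only [add_neg_cancel_left] using (mul_Sker_add (μ := μ) (φ := φ) z (-z + w)).symm
  · rw [hF]
    exact contDiff_const.mul (contDiff_one_iff_hasFDerivAt.2 ⟨_, hcont, hderiv⟩)
  · have hFz := (hderiv z).const_mul (Real.pi : ℂ)⁻¹
    have hμz := hμ.differentiable one_ne_zero z
    have hdiff : DifferentiableAt ℝ (fun z => ∫ w in ball w₀ r', φ w * Sker μ w z) z := by
      rw [hF]; exact hFz.differentiableAt
    have hT := integrable_mul_sub_mul_inv_sq hμ hμsupp hφ1.continuous hφc hk hμk z
    have hFv : ∫ w in ball w₀ r', φ w * Sker μ w z =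
        (Real.pi : ℂ)⁻¹ * ∫ u, beltramiKernel μ φ (z + u) u := congrFun hF z
    rw [dZbar_sub_dZ_mul hμz hdiff, hFv, hF, hFz.fderiv, beltramiSymbol_smul,
      hball z fun w => dZbar (fun ζ => Sker μ w ζ) z - dZ (fun ζ => μ ζ * Sker μ w ζ) z]
    have hcongr : ∀ᵐ u : ℂ, φ (z + u) * (dZbar (fun ζ => Sker μ (z + u) ζ) z -
        dZ (fun ζ => μ ζ * Sker μ (z + u) ζ) z) =
        (Real.pi : ℂ)⁻¹ * (φ (z + u) * (μ (z + u) - μ z) *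
          ((u + μ (z + u) * (starRingEnd ℂ) u) ^ 2)⁻¹) -
        (Real.pi : ℂ)⁻¹ * dZ μ z * beltramiKernel μ φ (z + u) u := by
      filter_upwards [hae] with u hu
      have hS := hasFDerivAt_Sker_s15 hk hμk z hu
      rw [dZbar_sub_dZ_mul hμz hS.differentiableAt, hS.fderiv, beltramiSymbol_smul,
        beltramiSymbol_id_add_smul_conj]
      linear_combination -dZ μ z * mul_Sker_add (μ := μ) (φ := φ) z u
    rw [integral_congr_ae hcongr, integral_sub (hT.const_mul _) ((hK z).const_mul _),
      integral_const_mul, integral_const_mul,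
      integral_mul_sub_mul_inv_sq hμ hμsupp hφ1 hφc hk hμk z]
    have hpi : (Real.pi : ℂ) ≠ 0 := by exact_mod_cast Real.pi_ne_zero
    field_simp
    ring
end
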